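/- arXiv:2601.02866 — 5 statements merged into one kernel-verified Lean document; each statement's English description precedes it below -/
import Mathlib

section
/- For every s with Re s > 0 and every y ∈ ℝ, ∫_0^∞ cos(τy)·Γ((s+iτ)/2)·Γ((s−iτ)/2) dτ = π·2^{1−s}·Γ(s)/(cosh y)^s. -/
open MeasureTheory Complex

open scoped FourierTransform in
lemma aux_point (a b : ℂ) (u : ℝ) :
    |2 * (Real.sigmoid (2 * u) * (1 - Real.sigmoid (2 * u)))| •
      (((Real.sigmoid (2 * u) : ℝ) : ℂ) ^ (a - 1) *
        (1 - ((Real.sigmoid (2 * u) : ℝ) : ℂ)) ^ (b - 1)) =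
      2 * (Complex.exp ((a - b) * u) * ((2 * Real.cosh u : ℝ) : ℂ) ^ (-(a + b))) := by
  have hc : 0 < 2 * Real.cosh u := by have := Real.cosh_pos u; positivity
  have h1 : Real.sigmoid (2 * u) = Real.exp (u - Real.log (2 * Real.cosh u)) := by
    rw [Real.exp_sub, Real.exp_log hc, Real.sigmoid_def, Real.cosh_eq]
    have : Real.exp (-(2 * u)) = Real.exp (-u) / Real.exp u := by
      rw [← Real.exp_sub]; ring_nf
    rw [this]
    have := Real.exp_pos u
    have := Real.exp_pos (-u)
    field_simp
  have h2 : 1 - Real.sigmoid (2 * u) = Real.exp (-u - Real.log (2 * Real.cosh u)) := by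
    rw [← Real.sigmoid_neg, Real.exp_sub, Real.exp_log hc, Real.sigmoid_def, Real.cosh_eq]
    have : Real.exp (-(-(2 * u))) = Real.exp u / Real.exp (-u) := by
      rw [← Real.exp_sub]; ring_nf
    rw [this]
    have := Real.exp_pos u
    have := Real.exp_pos (-u)
    field_simp
    ring
  have h3 : (1 - ((Real.sigmoid (2 * u) : ℝ) : ℂ)) = ((1 - Real.sigmoid (2 * u) : ℝ) : ℂ) := by
    push_cast; rfl
  have key : ∀ (x : ℝ) (z : ℂ), ((Real.exp x : ℝ) : ℂ) ^ z = Complex.exp (x * z) := by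
    intro x z
    rw [Complex.cpow_def_of_ne_zero (by exact_mod_cast (Real.exp_pos x).ne'),
      ← Complex.ofReal_log (Real.exp_pos x).le, Real.log_exp]
  rw [h3, h2, h1, abs_of_pos (by positivity), key, key, Complex.real_smul,
    Complex.cpow_def_of_ne_zero (by exact_mod_cast hc.ne'), ← Complex.ofReal_log hc.le]
  generalize Real.log (2 * Real.cosh u) = L
  push_cast
  rw [mul_assoc, ← Complex.exp_add, ← Complex.exp_add, ← Complex.exp_add, ← Complex.exp_add]
  congr 2
  ring

lemma aux_image : Set.image (fun u : ℝ => Real.sigmoid (2 * u)) Set.univ = Set.Ioo 0 1 := by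
  rw [Set.image_univ, ← Real.range_sigmoid]
  ext x
  constructor
  · rintro ⟨u, rfl⟩; exact ⟨2 * u, rfl⟩
  · rintro ⟨u, rfl⟩; exact ⟨u / 2, by simp only; congr 1; ring⟩

lemma aux_deriv (u : ℝ) : HasDerivWithinAt (fun u : ℝ => Real.sigmoid (2 * u))
    (2 * (Real.sigmoid (2 * u) * (1 - Real.sigmoid (2 * u)))) Set.univ u := by
  have h : HasDerivAt (fun u : ℝ => 2 * u) 2 u := by
    simpa using (hasDerivAt_id u).const_mul 2
  have := (Real.hasDerivAt_sigmoid (2 * u)).comp u h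
  rw [mul_comm 2]
  exact this.hasDerivWithinAt

lemma aux_inj : Set.InjOn (fun u : ℝ => Real.sigmoid (2 * u)) Set.univ := by
  intro x _ y _ h
  have := Real.sigmoid_injective h
  linarith

lemma aux_integrable (a b : ℂ) (ha : 0 < a.re) (hb : 0 < b.re) :
    Integrable (fun u : ℝ =>
      Complex.exp ((a - b) * u) * ((2 * Real.cosh u : ℝ) : ℂ) ^ (-(a + b))) := by
  have h := Complex.betaIntegral_convergent ha hb
  rw [intervalIntegrable_iff_integrableOn_Ioo_of_le zero_le_one, ← aux_image,
    integrableOn_image_iff_integrableOn_abs_deriv_smul MeasurableSet.univ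
      (fun u _ => aux_deriv u) aux_inj, integrableOn_univ] at h
  simp_rw [aux_point] at h
  simpa [← mul_assoc] using h.const_mul (1 / 2)

lemma aux_integral (a b : ℂ) (ha : 0 < a.re) (hb : 0 < b.re) :
    ∫ u : ℝ, Complex.exp ((a - b) * u) * ((2 * Real.cosh u : ℝ) : ℂ) ^ (-(a + b))
      = 1 / 2 * (Gamma a * Gamma b / Gamma (a + b)) := by
  rw [← Complex.betaIntegral_eq_Gamma_mul_div a b ha hb, Complex.betaIntegral,
    intervalIntegral.integral_of_le zero_le_one, integral_Ioc_eq_integral_Ioo, ← aux_image,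
    integral_image_eq_integral_abs_deriv_smul MeasurableSet.univ
      (fun u _ => aux_deriv u) aux_inj, setIntegral_univ]
  simp_rw [aux_point]
  rw [integral_const_mul]
  ring

lemma norm_Gamma_bound (z : ℂ) (hz : 0 < z.re) : ‖Gamma z‖ ≤ Real.Gamma z.re := by
  rw [Complex.Gamma_eq_integral hz, Real.Gamma_eq_integral hz, Complex.GammaIntegral]
  refine (norm_integral_le_integral_norm _).trans (le_of_eq ?_)
  refine setIntegral_congr_fun measurableSet_Ioi fun x hx => ?_
  have hx : 0 < x := hx
  simp only [norm_mul]
  rw [Complex.norm_cpow_eq_rpow_re_of_pos hx, Complex.norm_real, Real.norm_of_nonneg (Real.exp_pos _).le]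
  simp

lemma gamma_integrable (s : ℂ) (hs : 0 < s.re) :
    Integrable (fun τ : ℝ => Gamma ((s + τ * I) / 2) * Gamma ((s - τ * I) / 2)) := by
  have hra : ∀ τ : ℝ, ((s + τ * I) / 2).re = s.re / 2 := by intro τ; simp
  have hrb : ∀ τ : ℝ, ((s - τ * I) / 2).re = s.re / 2 := by intro τ; simp
  set K := Real.Gamma (s.re / 2 + 1) with hK
  have hbase : ∀ c : ℝ, Integrable (fun τ : ℝ => (s.re ^ 2 + (τ + c) ^ 2)⁻¹) := by
    intro c
    have h := ((integrable_inv_one_add_sq.comp_div hs.ne').comp_add_right c).const_mul ((s.re ^ 2)⁻¹)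
    refine h.congr (Filter.Eventually.of_forall fun τ => ?_)
    simp only
    have : 0 < s.re ^ 2 + (τ + c) ^ 2 := by positivity
    field_simp
  have hint := ((hbase s.im).add (hbase (-s.im))).const_mul (2 * K ^ 2)
  refine hint.mono' ?_ (Filter.Eventually.of_forall fun τ => ?_)
  · apply Continuous.aestronglyMeasurable
    have hG : ∀ f : ℝ → ℂ, Continuous f → (∀ τ, 0 < (f τ).re) → Continuous fun τ => Gamma (f τ) := by
      intro f hf hp
      refine continuous_iff_continuousAt.2 fun τ => ?_
      refine ContinuousAt.comp (f := f) (g := Gamma) ?_ hf.continuousAt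
      refine (Complex.differentiableAt_Gamma _ fun m h => ?_).continuousAt
      have := hp τ
      rw [h] at this
      simp at this
      linarith [(Nat.cast_nonneg m : (0:ℝ) ≤ m)]
    exact (hG _ (by fun_prop) fun τ => by rw [hra]; linarith).mul
      (hG _ (by fun_prop) fun τ => by rw [hrb]; linarith)
  · have hgen : ∀ z : ℂ, z.re = s.re / 2 → ‖Gamma z‖ ≤ K / ‖z‖ := by
      intro z hz
      have hz0 : z ≠ 0 := by rintro rfl; simp at hz; linarith
      rw [le_div_iff₀ (norm_pos_iff.2 hz0), mul_comm, ← norm_mul, ← Complex.Gamma_add_one z hz0]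
      have := norm_Gamma_bound (z + 1) (by simp; linarith)
      simpa [hz, hK] using this
    have hA := hgen _ (hra τ)
    have hB := hgen _ (hrb τ)
    have nA : ‖(s + τ * I) / 2‖ ^ 2 = (s.re ^ 2 + (τ + s.im) ^ 2) / 4 := by
      rw [← Complex.normSq_eq_norm_sq, Complex.normSq_apply]; simp; ring
    have nB : ‖(s - τ * I) / 2‖ ^ 2 = (s.re ^ 2 + (τ + -s.im) ^ 2) / 4 := by
      rw [← Complex.normSq_eq_norm_sq, Complex.normSq_apply]; simp; ring
    set p := ‖(s + τ * I) / 2‖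
    set q := ‖(s - τ * I) / 2‖
    have e1 : s.re ^ 2 + (τ + s.im) ^ 2 = 4 * p ^ 2 := by rw [nA]; ring
    have e2 : s.re ^ 2 + (τ + -s.im) ^ 2 = 4 * q ^ 2 := by rw [nB]; ring
    rw [norm_mul]
    calc _ ≤ K / p * (K / q) := mul_le_mul hA hB (norm_nonneg _) ((norm_nonneg _).trans hA)
      _ ≤ _ := by
        simp only [Pi.add_apply]
        rw [e1, e2, mul_inv, mul_inv, ← inv_pow, ← inv_pow, div_eq_mul_inv, div_eq_mul_inv]
        nlinarith [mul_nonneg (sq_nonneg K) (sq_nonneg (p⁻¹ - q⁻¹))]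

open scoped FourierTransform in
lemma full_integral (s : ℂ) (hs : 0 < s.re) (y : ℝ) :
    ∫ τ : ℝ, Complex.exp (τ * y * I) *
      (Gamma ((s + τ * I) / 2) * Gamma ((s - τ * I) / 2)) =
      4 * Real.pi * Gamma s * ((2 * Real.cosh y : ℝ) : ℂ) ^ (-s) := by
  set F : ℝ → ℂ := fun τ => Gamma ((s + τ * I) / 2) * Gamma ((s - τ * I) / 2) with hF
  set g : ℝ → ℂ := fun u => ((2 * Real.cosh u : ℝ) : ℂ) ^ (-s) with hg
  have hGs : Gamma s ≠ 0 := Complex.Gamma_ne_zero_of_re_pos hs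
  have hpi : (Real.pi : ℂ) ≠ 0 := by exact_mod_cast Real.pi_ne_zero
  have hgi : Integrable g := by
    have := aux_integrable (s / 2) (s / 2) (by simpa using hs) (by simpa using hs)
    simpa [hg] using this
  have hgc : Continuous g := by
    refine continuous_iff_continuousAt.2 fun u => ?_
    refine ContinuousAt.cpow (by fun_prop) (by fun_prop) ?_
    exact ofReal_mem_slitPlane.2 (by have := Real.cosh_pos u; positivity)
  have hFg : 𝓕 g = fun w : ℝ => 1 / (2 * Gamma s) * F (2 * Real.pi * w) := by
    ext w
    rw [Real.fourier_real_eq_integral_exp_smul]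
    have := aux_integral ((s - (2 * Real.pi * w : ℝ) * I) / 2) ((s + (2 * Real.pi * w : ℝ) * I) / 2)
      (by simp; linarith) (by simp; linarith)
    have e : (s - (2 * Real.pi * w : ℝ) * I) / 2 + (s + (2 * Real.pi * w : ℝ) * I) / 2 = s := by ring
    rw [e] at this
    rw [hF]
    simp only
    trans 1 / 2 * (Gamma ((s - (2 * Real.pi * w : ℝ) * I) / 2) *
      Gamma ((s + (2 * Real.pi * w : ℝ) * I) / 2) / Gamma s)
    · rw [← this]
      congr 1
      ext u
      rw [smul_eq_mul]
      congr 2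
      push_cast
      ring
    · field_simp
  have hFi : Integrable (𝓕 g) := by
    rw [hFg]
    exact ((gamma_integrable s hs).comp_mul_left' (by positivity)).const_mul _
  have hinv := congrFun (hgc.fourierInv_fourier_eq hgi hFi) y
  rw [Real.fourierInv_eq', hFg] at hinv
  have hsc := Measure.integral_comp_mul_left
    (fun τ : ℝ => Complex.exp (τ * y * I) * F τ) (2 * Real.pi)
  have h2 : ∫ v : ℝ, Complex.exp ((2 * Real.pi * v : ℝ) * y * I) * F (2 * Real.pi * v) =
      2 * Gamma s * g y := by
    rw [← hinv, ← integral_const_mul]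
    congr 1
    ext v
    simp only [smul_eq_mul, RCLike.inner_apply, conj_trivial]
    have : ((2 * Real.pi * v : ℝ) * y * I : ℂ) = ((2 * Real.pi * (y * v) : ℝ) : ℂ) * I := by
      push_cast; ring
    rw [this]
    field_simp
  rw [h2, abs_of_pos (by positivity), Complex.real_smul] at hsc
  push_cast at hsc
  change _ = 4 * Real.pi * Gamma s * g y
  field_simp at hsc
  rw [← hsc]
  ring

theorem integral_cos_gamma (s : ℂ) (hs : 0 < s.re) (y : ℝ) :
    ∫ τ in Set.Ioi (0:ℝ),
        (Real.cos (τ * y) : ℂ) *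
          (Complex.Gamma ((s + τ * Complex.I) / 2) *
            Complex.Gamma ((s - τ * Complex.I) / 2))
      = (Real.pi : ℂ) * (2:ℂ) ^ ((1:ℂ) - s) * Complex.Gamma s /
          (Real.cosh y : ℂ) ^ s := by
  have h1 := full_integral s hs y
  have h2 := full_integral s hs (-y)
  rw [Real.cosh_neg] at h2
  have hbd : ∀ y : ℝ, Integrable fun τ : ℝ => Complex.exp (τ * y * I) *
      (Gamma ((s + τ * I) / 2) * Gamma ((s - τ * I) / 2)) := by
    intro y
    refine (gamma_integrable s hs).bdd_mul (c := 1)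
      (by apply Continuous.aestronglyMeasurable; fun_prop)
      (Filter.Eventually.of_forall fun τ => ?_)
    rw [← Complex.ofReal_mul, Complex.norm_exp_ofReal_mul_I]
  set f : ℝ → ℂ := fun τ => (Real.cos (τ * y) : ℂ) *
          (Complex.Gamma ((s + τ * Complex.I) / 2) *
            Complex.Gamma ((s - τ * Complex.I) / 2)) with hf
  have hfe : ∀ τ : ℝ, f τ = 1 / 2 * (Complex.exp (τ * y * I) *
      (Gamma ((s + τ * I) / 2) * Gamma ((s - τ * I) / 2)) +
      Complex.exp (τ * (-y : ℝ) * I) *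
      (Gamma ((s + τ * I) / 2) * Gamma ((s - τ * I) / 2))) := by
    intro τ
    simp only [hf]
    rw [Complex.ofReal_cos, Complex.cos]
    push_cast
    ring_nf
  have hfi : Integrable f := by
    rw [funext hfe]
    exact ((hbd y).add (hbd (-y))).const_mul _
  have hfull : ∫ τ, f τ = 4 * Real.pi * Gamma s * ((2 * Real.cosh y : ℝ) : ℂ) ^ (-s) := by
    simp_rw [hfe]
    rw [integral_const_mul, integral_add (hbd y) (hbd (-y)), h1, h2]
    ring
  have heven : ∀ τ, f (-τ) = f τ := by
    intro τ
    simp only [hf]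
    rw [neg_mul, Real.cos_neg, mul_comm (Gamma _)]
    push_cast
    ring_nf
  have hneg : ∫ τ in Set.Iic (0:ℝ), f τ = ∫ τ in Set.Ioi (0:ℝ), f τ := by
    have := integral_comp_neg_Ioi 0 f
    simp_rw [heven, neg_zero] at this
    exact this.symm
  rw [← integral_add_compl (s := Set.Ioi 0) measurableSet_Ioi hfi, Set.compl_Ioi, hneg] at hfull
  have hc := Real.cosh_pos y
  rw [Complex.ofReal_mul, Complex.mul_cpow_ofReal_nonneg (by norm_num) hc.le] at hfull
  rw [Complex.cpow_sub _ _ two_ne_zero, Complex.cpow_one]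
  simp only [Complex.cpow_neg, Complex.ofReal_ofNat] at hfull
  simp only [div_eq_mul_inv]
  linear_combination (1 / 2) * hfull
end

section
/- For every x > 0 and y ∈ ℝ, ∫_0^∞ cos(τy)·(K_{iτ}(x))² dτ = (π/2)·K_0(2x·cosh(y/2)). -/
open MeasureTheory Real

/-- Macdonald function of purely imaginary order `iτ`. -/
noncomputable def Kit (τ x : ℝ) : ℝ :=
  ∫ t in Set.Ioi (0:ℝ), Real.exp (-x * Real.cosh t) * Real.cos (τ * t)

/-- Macdonald function of order `0`: `K_0(z) = ∫_0^∞ exp(−z cosh t) dt`. -/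
noncomputable def K0 (z : ℝ) : ℝ :=
  ∫ t in Set.Ioi (0:ℝ), Real.exp (-z * Real.cosh t)

open scoped FourierTransform Convolution in
/-- Fourier transform of an even, integrable real function as a cosine transform. -/
lemma fourier_even_aux (f : ℝ → ℝ) (hf : Integrable f) (he : ∀ t, f (-t) = f t) (w : ℝ) :
    𝓕 (fun t => (f t : ℂ)) w
      = ((2 * ∫ t in Set.Ioi (0:ℝ), f t * Real.cos (2 * π * w * t) : ℝ) : ℂ) := by
  have hc : Integrable (fun t => f t * Real.cos (2 * π * w * t)) :=
    hf.mul_bdd (c := 1) (by fun_prop) (Filter.Eventually.of_forall fun t => by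
      simpa using Real.abs_cos_le_one _)
  have hs : Integrable (fun t => f t * Real.sin (2 * π * w * t)) :=
    hf.mul_bdd (c := 1) (by fun_prop) (Filter.Eventually.of_forall fun t => by
      simpa using Real.abs_sin_le_one _)
  have hs0 : ∫ t, f t * Real.sin (2 * π * w * t) = 0 := by
    have h := integral_neg_eq_self (fun t => f t * Real.sin (2 * π * w * t)) volume
    simp only [he, mul_neg, Real.sin_neg, integral_neg] at h
    linarith
  have hc0 : ∫ t, f t * Real.cos (2 * π * w * t)
      = 2 * ∫ t in Set.Ioi (0:ℝ), f t * Real.cos (2 * π * w * t) := by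
    rw [← integral_comp_abs (f := fun t => f t * Real.cos (2 * π * w * t))]
    congr 1
    ext t
    rcases abs_choice t with h | h <;> rw [h]
    simp [he]
  rw [Real.fourier_real_eq_integral_exp_smul, ← hc0]
  have : ∀ t : ℝ, Complex.exp (↑(-2 * π * t * w) * Complex.I) • (f t : ℂ)
      = ((f t * Real.cos (2 * π * w * t) : ℝ) : ℂ)
        - ((f t * Real.sin (2 * π * w * t) : ℝ) : ℂ) * Complex.I := by
    intro t
    rw [Complex.exp_mul_I, ← Complex.ofReal_cos, ← Complex.ofReal_sin,
      show -2 * π * t * w = -(2 * π * w * t) by ring, Real.cos_neg, Real.sin_neg]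
    push_cast
    simp only [smul_eq_mul]
    ring
  simp_rw [this]
  rw [integral_sub hc.ofReal (hs.ofReal.mul_const _), integral_mul_const, integral_complex_ofReal,
    integral_complex_ofReal, hs0]
  simp

lemma sq_div_four_le_cosh_aux (t : ℝ) : t ^ 2 / 4 ≤ Real.cosh t := by
  rw [← Real.cosh_abs, Real.cosh_eq]
  have h1 := Real.quadratic_le_exp_of_nonneg (abs_nonneg t)
  have h2 := Real.exp_pos (-|t|)
  rw [sq_abs] at h1
  have h3 := abs_nonneg t
  linarith

lemma integrable_exp_cosh_aux {x : ℝ} (hx : 0 < x) :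
    Integrable (fun t : ℝ => Real.exp (-x * Real.cosh t)) := by
  refine (integrable_exp_neg_mul_sq (b := x / 4) (by positivity)).mono'
    (by fun_prop) (Filter.Eventually.of_forall fun t => ?_)
  rw [Real.norm_eq_abs, abs_of_pos (Real.exp_pos _)]
  apply Real.exp_le_exp.2
  nlinarith [sq_div_four_le_cosh_aux t]

lemma hasDerivAt_aux (x t : ℝ) : HasDerivAt (fun t : ℝ => ((Real.exp (-x * Real.cosh t) : ℝ) : ℂ))
    ((Real.exp (-x * Real.cosh t) * (-x * Real.sinh t) : ℝ) : ℂ) t :=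
  (((Real.hasDerivAt_cosh t).const_mul (-x)).exp).ofReal_comp

lemma integrable_deriv_aux {x : ℝ} (hx : 0 < x) :
    Integrable (fun t : ℝ => Real.exp (-x * Real.cosh t) * (-x * Real.sinh t)) := by
  refine ((integrable_exp_cosh_aux (half_pos hx)).const_mul 2).mono'
    (by fun_prop) (Filter.Eventually.of_forall fun t => ?_)
  have hsc : |Real.sinh t| ≤ Real.cosh t := by
    rw [abs_le]
    have := Real.exp_pos t
    have := Real.exp_pos (-t)
    rw [Real.sinh_eq, Real.cosh_eq]
    constructor <;> linarith
  rw [Real.norm_eq_abs, abs_mul, abs_mul, abs_neg, abs_of_pos hx, abs_of_pos (Real.exp_pos _)]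
  have h1 : x * |Real.sinh t| ≤ 2 * Real.exp (x / 2 * Real.cosh t) := by
    have := Real.add_one_le_exp (x / 2 * Real.cosh t)
    nlinarith
  calc Real.exp (-x * Real.cosh t) * (x * |Real.sinh t|)
      ≤ Real.exp (-x * Real.cosh t) * (2 * Real.exp (x / 2 * Real.cosh t)) := by gcongr
    _ = 2 * (Real.exp (-x * Real.cosh t) * Real.exp (x / 2 * Real.cosh t)) := by ring
    _ = 2 * Real.exp (-(x / 2) * Real.cosh t) := by
        rw [← Real.exp_add]; congr 2; ring

open scoped FourierTransform in
lemma norm_fourier_le_aux (f : ℝ → ℂ) (w : ℝ) : ‖𝓕 f w‖ ≤ ∫ t, ‖f t‖ :=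
  VectorFourier.norm_fourierIntegral_le_integral_norm _ _ _ _ _

open scoped FourierTransform in
lemma continuous_fourier_aux (f : ℝ → ℂ) (hf : Integrable f) : Continuous (𝓕 f) :=
  VectorFourier.fourierIntegral_continuous Real.continuous_fourierChar
    (by exact continuous_inner) hf

lemma conv_aux (z u : ℝ) :
    ∫ t : ℝ, Real.exp (-z * Real.cosh t) * Real.exp (-z * Real.cosh (u - t))
      = 2 * K0 (2 * z * Real.cosh (u / 2)) := by
  have h : ∀ t : ℝ, Real.exp (-z * Real.cosh t) * Real.exp (-z * Real.cosh (u - t))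
      = Real.exp (-(2 * z * Real.cosh (u / 2)) * Real.cosh (t - u / 2)) := by
    intro t
    rw [← Real.exp_add]
    congr 1
    have e1 : Real.cosh t = Real.cosh (u / 2 + (t - u / 2)) := by congr 1; ring
    have e2 : Real.cosh (u - t) = Real.cosh (u / 2 - (t - u / 2)) := by congr 1; ring
    rw [Real.cosh_add] at e1
    rw [Real.cosh_sub (u / 2)] at e2
    linear_combination (-z) * e1 + (-z) * e2
  simp_rw [h]
  rw [integral_sub_right_eq_self
    (fun t => Real.exp (-(2 * z * Real.cosh (u / 2)) * Real.cosh t)) (u / 2), K0,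
    ← integral_comp_abs (f := fun t => Real.exp (-(2 * z * Real.cosh (u / 2)) * Real.cosh t))]
  simp

open scoped FourierTransform Convolution in
theorem integral_cos_Kit_sq (x y : ℝ) (hx : 0 < x) :
    ∫ τ in Set.Ioi (0:ℝ), Real.cos (τ * y) * (Kit τ x) ^ 2
      = (Real.pi / 2) * K0 (2 * x * Real.cosh (y / 2)) := by
  set f : ℝ → ℂ := fun t => ((Real.exp (-x * Real.cosh t) : ℝ) : ℂ) with hf
  have hfi : Integrable f := (integrable_exp_cosh_aux hx).ofReal
  have hfc : Continuous f := by rw [hf]; fun_prop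
  have hF : ∀ w, 𝓕 f w = ((2 * Kit (2 * π * w) x : ℝ) : ℂ) := fun w =>
    fourier_even_aux _ (integrable_exp_cosh_aux hx) (fun t => by simp) w
  have hfd : deriv f = fun t => ((Real.exp (-x * Real.cosh t) * (-x * Real.sinh t) : ℝ) : ℂ) :=
    funext fun t => (hasDerivAt_aux x t).deriv
  have hfdi : Integrable (deriv f) := by
    rw [hfd]; exact (integrable_deriv_aux hx).ofReal
  have hFd := Real.fourier_deriv hfi (fun t => (hasDerivAt_aux x t).differentiableAt) hfdi
  set g : ℝ → ℂ := f ⋆[ContinuousLinearMap.mul ℂ ℂ] f with hg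
  have hgi : Integrable g := hfi.integrable_convolution _ hfi
  have hgc : Continuous g := by
    refine BddAbove.continuous_convolution_right_of_integrable _ ⟨1, ?_⟩ hfi hfc
    rintro _ ⟨t, rfl⟩
    simp only [hf, Complex.norm_real, Real.norm_eq_abs, Real.abs_exp]
    rw [Real.exp_le_one_iff]
    nlinarith [Real.cosh_pos t]
  have hgv : ∀ u, g u = ((2 * K0 (2 * x * Real.cosh (u / 2)) : ℝ) : ℂ) := by
    intro u
    rw [← conv_aux, ← integral_complex_ofReal]
    simp only [hg, convolution, hf, ContinuousLinearMap.mul_apply', Complex.ofReal_mul]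
  have hG : 𝓕 g = fun w => (((2 * Kit (2 * π * w) x) ^ 2 : ℝ) : ℂ) := by
    funext w
    rw [hg, Real.fourier_mul_convolution_eq hfi hfi, hF]
    push_cast; ring
  set A := ∫ t, ‖f t‖
  set B := ∫ t, ‖deriv f t‖
  have hKi : Integrable (fun w => (2 * Kit (2 * π * w) x) ^ 2) := by
    have hcont : Continuous (fun w => (2 * Kit (2 * π * w) x) ^ 2) := by
      have : (fun w => (2 * Kit (2 * π * w) x) ^ 2) = fun w => (𝓕 f w).re ^ 2 := by
        funext w; rw [hF, Complex.ofReal_re]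
      rw [this]
      exact (Complex.continuous_re.comp (continuous_fourier_aux f hfi)).pow 2
    refine (integrable_inv_one_add_sq.const_mul (A ^ 2 + B ^ 2)).mono'
      hcont.aestronglyMeasurable (Filter.Eventually.of_forall fun w => ?_)
    have h1 : |2 * Kit (2 * π * w) x| ≤ A := by
      have := norm_fourier_le_aux f w
      rwa [hF, Complex.norm_real, Real.norm_eq_abs] at this
    have h2 : |w| * |2 * Kit (2 * π * w) x| ≤ B := by
      have h := norm_fourier_le_aux (deriv f) w
      rw [hFd] at h
      simp only [hF, norm_smul, norm_mul, Complex.norm_real, Complex.norm_I, Real.norm_eq_abs,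
        Complex.norm_ofNat, abs_of_pos Real.pi_pos, mul_one] at h
      refine le_trans ?_ h
      have hp : 0 ≤ |w| * |2 * Kit (2 * π * w) x| := by positivity
      have hpi := Real.pi_gt_three
      rw [← abs_mul 2, mul_assoc (2 * π)]
      nlinarith
    rw [Real.norm_eq_abs, abs_of_nonneg (sq_nonneg _), ← div_eq_mul_inv,
      le_div_iff₀ (by positivity), ← sq_abs]
    have h3 : (|w| * |2 * Kit (2 * π * w) x|) ^ 2 ≤ B ^ 2 := by gcongr
    have h4 : |2 * Kit (2 * π * w) x| ^ 2 ≤ A ^ 2 := by gcongr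
    rw [mul_pow, sq_abs w] at h3
    linarith
  have hinv : 𝓕⁻ (𝓕 g) = g := hgc.fourierInv_fourier_eq hgi (by rw [hG]; exact hKi.ofReal)
  have hev : ∀ w, (2 * Kit (2 * π * (-w)) x) ^ 2 = (2 * Kit (2 * π * w) x) ^ 2 := by
    intro w; simp [Kit]
  have key := congrFun hinv y
  rw [Real.fourierInv_eq_fourier_neg, hG, fourier_even_aux _ hKi hev, hgv] at key
  have key := Complex.ofReal_injective key
  have hsub := integral_comp_mul_left_Ioi
    (fun τ => Real.cos (τ * y) * (Kit τ x) ^ 2) 0 (b := 2 * π) (by positivity)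
  have e : ∀ t, (2 * Kit (2 * π * t) x) ^ 2 * Real.cos (2 * π * (-y) * t)
      = 4 * (Real.cos (2 * π * t * y) * (Kit (2 * π * t) x) ^ 2) := by
    intro t
    rw [show 2 * π * (-y) * t = -(2 * π * t * y) by ring, Real.cos_neg]; ring
  simp_rw [e] at key
  rw [integral_const_mul, hsub, mul_zero, smul_eq_mul] at key
  have hpi := Real.pi_pos
  field_simp at key
  linarith
end

section
/- For every ν ∈ ℂ and x, y > 0, K_ν(x)·K_ν(y) = (1/2)·∫_0^∞ exp(−(1/2)·(t·(x²+y²)/(xy) + xy/t))·K_ν(t)·(dt/t). -/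
open MeasureTheory Complex

/-- Macdonald function of complex order `ν` and positive argument `x`:
`K_ν(x) = ∫_0^∞ exp(−x cosh t) cosh(ν t) dt`. -/
noncomputable def Kc (ν : ℂ) (x : ℝ) : ℂ :=
  ∫ t in Set.Ioi (0:ℝ), Complex.exp (-(x:ℂ) * Real.cosh t) * Complex.cosh (ν * t)

lemma cosh_quad (u : ℝ) : u ^ 2 / 4 ≤ Real.cosh u := by
  rw [← Real.cosh_abs, Real.cosh_eq]
  have h := Real.quadratic_le_exp_of_nonneg (abs_nonneg u)
  have h2 := Real.exp_pos (-|u|)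
  have h3 := abs_nonneg u
  have h4 := sq_abs u
  nlinarith

noncomputable def kerK (ν : ℂ) (x : ℝ) (u : ℝ) : ℂ :=
  Complex.exp (-(x:ℂ) * Real.cosh u) * Complex.exp (ν * u)

lemma kerK_cont (ν : ℂ) (x : ℝ) : Continuous (kerK ν x) := by
  unfold kerK
  have := Real.continuous_cosh
  fun_prop

lemma kerK_integrable (ν : ℂ) (x : ℝ) (hx : 0 < x) : Integrable (kerK ν x) := by
  have h := integrable_cexp_quadratic (b := ((x/4 : ℝ) : ℂ))
    (by rw [Complex.ofReal_re]; positivity) ν 0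
  refine h.mono (kerK_cont ν x).aestronglyMeasurable (Filter.Eventually.of_forall fun u => ?_)
  rw [kerK, ← Complex.exp_add, Complex.norm_exp, Complex.norm_exp, Real.exp_le_exp]
  have h1 : (-(x:ℂ) * Real.cosh u + ν * u).re = -x * Real.cosh u + ν.re * u := by
    rw [Complex.add_re, Complex.re_mul_ofReal, Complex.re_mul_ofReal]; simp
  have h2 : (-((x/4 : ℝ) : ℂ) * (u:ℂ)^2 + ν * u + 0).re = -(x/4) * u^2 + ν.re * u := by
    rw [add_zero, Complex.add_re, ← Complex.ofReal_pow, Complex.re_mul_ofReal,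
      Complex.re_mul_ofReal, Complex.neg_re, Complex.ofReal_re]
  rw [h1, h2]
  nlinarith [cosh_quad u]

lemma Kc_eq (ν : ℂ) (x : ℝ) (hx : 0 < x) : Kc ν x = (1/2 : ℂ) * ∫ u : ℝ, kerK ν x u := by
  have hi := kerK_integrable ν x hx
  have h0 := intervalIntegral.integral_Iic_add_Ioi (b := (0:ℝ)) (μ := volume)
    (f := kerK ν x) hi.integrableOn hi.integrableOn
  have h1 := integral_comp_neg_Ioi (0:ℝ) (kerK ν x)
  rw [neg_zero] at h1
  rw [← h0, ← h1, ← integral_add hi.comp_neg.integrableOn hi.integrableOn,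
    ← integral_const_mul, Kc]
  congr 1
  ext t
  have hch : Complex.cosh (ν * t) = (Complex.exp (ν * t) + Complex.exp (-(ν * t))) / 2 := rfl
  simp only [kerK, hch, Real.cosh_neg, Complex.ofReal_neg, mul_neg]
  ring

noncomputable def cfun (x y w : ℝ) : ℝ := Real.log (x * y / (x * Real.exp w + y))

lemma mp (x y : ℝ) : MeasurePreserving
    (fun p : ℝ × ℝ => (p.1 - (p.2 - cfun x y p.1), p.2 - cfun x y p.1))
    (volume.prod volume) (volume.prod volume) := by
  have hm : Measurable (cfun x y) := by unfold cfun; fun_prop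
  have h1 : MeasurePreserving (fun p : ℝ × ℝ => (id p.1, p.2 - cfun x y p.1))
      (volume.prod volume) (volume.prod volume) := by
    refine (MeasurePreserving.id volume).skew_product
      (g := fun w s => s - cfun x y w) ?_ (Filter.Eventually.of_forall fun w => ?_)
    · simp only [Function.uncurry_def]; fun_prop
    · exact (measurePreserving_sub_right volume (cfun x y w)).map_eq
  exact (measurePreserving_sub_prod (volume : Measure ℝ) (volume : Measure ℝ)).comp h1

lemma key (ν : ℂ) (x y : ℝ) (hx : 0 < x) (hy : 0 < y) (w s : ℝ) :
    kerK ν x (w - (s - cfun x y w)) * kerK ν y (s - cfun x y w)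
      = (Real.exp (-(1/2) * (Real.exp s * (x^2 + y^2) / (x*y) + x*y/Real.exp s)) : ℂ)
          * kerK ν (Real.exp s) w := by
  have hE := Real.exp_pos w
  have hS := Real.exp_pos s
  have hB : 0 < x * Real.exp w + y := by positivity
  have hc : Real.exp (cfun x y w) = x * y / (x * Real.exp w + y) := by
    rw [cfun, Real.exp_log (by positivity)]
  have hreal : -x * Real.cosh (w - (s - cfun x y w)) + -y * Real.cosh (s - cfun x y w)
      = -(1/2) * (Real.exp s * (x^2 + y^2) / (x*y) + x*y/Real.exp s)
        + -Real.exp s * Real.cosh w := by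
    simp only [Real.cosh_eq, neg_sub, Real.exp_sub, hc, Real.exp_neg]
    field_simp
    ring
  have hr := congrArg (fun r : ℝ => (r : ℂ)) hreal
  simp only [kerK, ofReal_exp, ← Complex.exp_add]
  congr 1
  push_cast at hr ⊢
  linear_combination hr

theorem Kc_mul_Kc (ν : ℂ) (x y : ℝ) (hx : 0 < x) (hy : 0 < y) :
    Kc ν x * Kc ν y
      = (1/2 : ℂ) * ∫ t in Set.Ioi (0:ℝ),
          (Real.exp (-(1/2) * (t * (x^2 + y^2) / (x*y) + x*y/t)) : ℂ)
            * Kc ν t / (t : ℂ) := by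
  have hf : Integrable (fun p : ℝ × ℝ => kerK ν x p.1 * kerK ν y p.2)
      ((volume : Measure ℝ).prod (volume : Measure ℝ)) :=
    (kerK_integrable ν x hx).mul_prod (kerK_integrable ν y hy)
  have hg := (mp x y).integrable_comp_of_integrable hf
  have hfg := integral_map (mp x y).measurable.aemeasurable
    (f := fun p : ℝ × ℝ => kerK ν x p.1 * kerK ν y p.2)
    (by rw [(mp x y).map_eq]; exact hf.aestronglyMeasurable)
  rw [(mp x y).map_eq, integral_prod_mul] at hfg
  simp only [Function.comp_def, key ν x y hx hy] at hg hfg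
  rw [integral_prod_symm _ hg] at hfg
  have hcv := integral_image_eq_integral_abs_deriv_smul (s := Set.univ) (f := Real.exp)
    (f' := Real.exp) MeasurableSet.univ
    (fun s _ => (Real.hasDerivAt_exp s).hasDerivWithinAt) Real.exp_injective.injOn
    (fun t : ℝ => (Real.exp (-(1/2) * (t * (x^2 + y^2) / (x*y) + x*y/t)) : ℂ)
            * Kc ν t / (t : ℂ))
  rw [Set.image_univ, Real.range_exp] at hcv
  rw [hcv, setIntegral_univ, Kc_eq ν x hx, Kc_eq ν y hy]
  have : ∀ s : ℝ, |Real.exp s| • ((Real.exp (-(1/2) * (Real.exp s * (x^2 + y^2) / (x*y)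
        + x*y/Real.exp s)) : ℂ) * Kc ν (Real.exp s) / (Real.exp s : ℂ))
      = (1/2 : ℂ) * ∫ w : ℝ, (Real.exp (-(1/2) * (Real.exp s * (x^2 + y^2) / (x*y)
        + x*y/Real.exp s)) : ℂ) * kerK ν (Real.exp s) w := by
    intro s
    have h : (Real.exp s : ℂ) ≠ 0 := by exact_mod_cast (Real.exp_pos s).ne'
    rw [integral_const_mul, Kc_eq ν _ (Real.exp_pos s), abs_of_pos (Real.exp_pos s),
      Complex.real_smul]
    field_simp
  simp only [this]
  rw [integral_const_mul, ← hfg]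
  ring
end

section
/- Define μ_n(x) = ∫_0^∞ τ^{2n}·(K_{iτ}(x))² dτ for x > 0. Then μ_0(x) = (π/2)·K_0(2x) and μ_1(x) = (π x/4)·K_1(2x). -/
open MeasureTheory Real

/-- Macdonald function of real order `ν`. -/
noncomputable def Kre (ν z : ℝ) : ℝ :=
  ∫ t in Set.Ioi (0:ℝ), Real.exp (-z * Real.cosh t) * Real.cosh (ν * t)

/-- Moments of the square of the Macdonald function. -/
noncomputable def μ (n : ℕ) (x : ℝ) : ℝ :=
  ∫ τ in Set.Ioi (0:ℝ), τ^(2*n) * (Kit τ x)^2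

open scoped FourierTransform

/-- Master integrability fact. -/
lemma integrable_of_le_cosh {x : ℝ} (hx : 0 < x) {g : ℝ → ℝ} (hg : Continuous g) {C : ℝ}
    (hC : ∀ t, |g t| ≤ C * (cosh t ^ 2 * exp (-x * cosh t))) : Integrable g := by
  have hC0 : 0 ≤ C := by
    have h1 := (abs_nonneg _).trans (hC 0)
    by_contra h
    push Not at h
    have : C * (cosh 0 ^ 2 * exp (-x * cosh 0)) < 0 :=
      mul_neg_of_neg_of_pos h (by have := cosh_pos 0; positivity)
    linarith
  have hI := integrable_inv_one_add_sq.const_mul (C * (24 / x ^ 4))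
  refine hI.mono' hg.aestronglyMeasurable (Filter.Eventually.of_forall fun t => ?_)
  rw [Real.norm_eq_abs]
  refine (hC t).trans ?_
  rw [mul_assoc]
  refine mul_le_mul_of_nonneg_left ?_ hC0
  have hc : 0 < cosh t := cosh_pos t
  have h1 : (x * cosh t) ^ 4 / 24 ≤ exp (x * cosh t) := by
    have := Real.pow_div_factorial_le_exp (x * cosh t) (by positivity) 4
    simpa [Nat.factorial] using this
  have h2 : 1 + t ^ 2 ≤ cosh t ^ 2 := by
    rw [Real.cosh_sq]
    have : |t| ≤ sinh |t| := self_le_sinh_iff.2 (abs_nonneg t)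
    have h3 : |t| ^ 2 ≤ (sinh |t|) ^ 2 := pow_le_pow_left₀ (abs_nonneg t) this 2
    rw [← Real.abs_sinh, sq_abs, sq_abs] at h3
    linarith
  have h4 : exp (-x * cosh t) = (exp (x * cosh t))⁻¹ := by rw [← Real.exp_neg]; ring_nf
  rw [h4, ← div_eq_mul_inv, ← div_eq_mul_inv, div_le_div_iff₀ (exp_pos _) (by positivity),
    div_mul_eq_mul_div, le_div_iff₀ (by positivity)]
  calc cosh t ^ 2 * (1 + t ^ 2) * x ^ 4 ≤ cosh t ^ 2 * cosh t ^ 2 * x ^ 4 := by gcongr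
    _ = 24 * ((x * cosh t) ^ 4 / 24) := by ring
    _ ≤ _ := by gcongr

/-- Parseval for an even continuous function with integrable transform. -/
lemma parseval_even {f g : ℝ → ℂ} (hf : Integrable f) (hg : Integrable g) (hc : Continuous f)
    (he : ∀ t, f (-t) = f t) (hF : Integrable (𝓕 f)) :
    ∫ w, 𝓕 g w * 𝓕 f w = ∫ t, g t * f t := by
  have h := VectorFourier.integral_fourierIntegral_smul_eq_flip (μ := volume) (ν := volume)
    (L := innerₗ ℝ) (e := Real.fourierChar) Real.continuous_fourierChar continuous_inner hg hF
  rw [flip_innerₗ] at h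
  have h2 : ∀ t, 𝓕 (𝓕 f) t = f t := by
    intro t
    have := congrFun (hc.fourierInv_fourier_eq hf hF) (-t)
    rw [fourierInv_eq_fourier_neg, neg_neg, he] at this
    exact this
  calc _ = ∫ t, g t * 𝓕 (𝓕 f) t := h
    _ = _ := by simp_rw [h2]

lemma integral_odd {g : ℝ → ℝ} (h : ∀ t, g (-t) = - g t) : ∫ t, g t = 0 := by
  have h1 := integral_neg_eq_self g volume
  simp_rw [h, integral_neg] at h1
  linarith

lemma two_half {g : ℝ → ℝ} (h : ∀ t, g (-t) = g t) : ∫ t, g t = 2 * ∫ t in Set.Ioi (0:ℝ), g t := by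
  rw [← integral_comp_abs]
  congr 1
  ext t
  rcases abs_choice t with h1 | h1 <;> rw [h1]
  exact (h t).symm

noncomputable def ff (x t : ℝ) : ℝ := exp (-x * cosh t)
noncomputable def ff1 (x t : ℝ) : ℝ := -x * sinh t * exp (-x * cosh t)
noncomputable def ff2 (x t : ℝ) : ℝ :=
  (x ^ 2 * sinh t ^ 2 - x * cosh t) * exp (-x * cosh t)

lemma hasDeriv_ff (x t : ℝ) : HasDerivAt (ff x) (ff1 x t) t := by
  have := ((hasDerivAt_cosh t).const_mul (-x)).exp
  refine this.congr_deriv ?_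
  unfold ff1; ring

lemma hasDeriv_ff1 (x t : ℝ) : HasDerivAt (ff1 x) (ff2 x t) t := by
  have := ((hasDerivAt_sinh t).const_mul (-x)).mul (((hasDerivAt_cosh t).const_mul (-x)).exp)
  refine this.congr_deriv ?_
  unfold ff2; ring

lemma abs_sinh_le (t : ℝ) : |sinh t| ≤ cosh t := by
  rw [abs_le]
  constructor
  · have := exp_pos t; rw [← Real.cosh_add_sinh] at this; linarith
  · exact (sinh_lt_cosh t).le

lemma cosh_le_sq (t : ℝ) : cosh t ≤ cosh t ^ 2 := by
  nlinarith [one_le_cosh t]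

lemma int_ff {x : ℝ} (hx : 0 < x) : Integrable (ff x) := by
  refine integrable_of_le_cosh hx (by unfold ff; fun_prop) (C := 1) fun t => ?_
  unfold ff
  rw [abs_of_pos (exp_pos _), one_mul]
  exact le_mul_of_one_le_left (exp_pos _).le (one_le_pow₀ (one_le_cosh t))

lemma int_ff1 {x : ℝ} (hx : 0 < x) : Integrable (ff1 x) := by
  refine integrable_of_le_cosh hx (by unfold ff1; fun_prop) (C := x) fun t => ?_
  unfold ff1
  rw [abs_mul, abs_mul, abs_neg, abs_of_pos (exp_pos _), abs_of_pos hx, mul_assoc]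
  gcongr
  exact (abs_sinh_le t).trans (cosh_le_sq t)

lemma int_ff2 {x : ℝ} (hx : 0 < x) : Integrable (ff2 x) := by
  refine integrable_of_le_cosh hx (by unfold ff2; fun_prop) (C := x ^ 2 + x) fun t => ?_
  unfold ff2
  rw [abs_mul, abs_of_pos (exp_pos _), ← mul_assoc]
  gcongr
  have h1 := cosh_le_sq t
  have h2 := Real.cosh_sq t
  have h3 := cosh_pos t
  rw [abs_le]
  constructor <;> nlinarith [mul_le_mul_of_nonneg_left h1 hx.le, mul_pos hx h3, sq_nonneg (x * sinh t), sq_nonneg x, mul_pos hx (mul_pos h3 h3)]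

noncomputable def cf (x t : ℝ) : ℂ := (ff x t : ℂ)
noncomputable def cf1 (x t : ℝ) : ℂ := (ff1 x t : ℂ)
noncomputable def cf2 (x t : ℝ) : ℂ := (ff2 x t : ℂ)

lemma fourier_cf2 {x : ℝ} (hx : 0 < x) (w : ℝ) :
    𝓕 (cf2 x) w = -((2 * π * w : ℝ) : ℂ) ^ 2 * 𝓕 (cf x) w := by
  have d1 : ∀ t, HasDerivAt (cf x) (cf1 x t) t := fun t => (hasDeriv_ff x t).ofReal_comp
  have d2 : ∀ t, HasDerivAt (cf1 x) (cf2 x t) t := fun t => (hasDeriv_ff1 x t).ofReal_comp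
  have e1 : deriv (cf x) = cf1 x := funext fun t => (d1 t).deriv
  have e2 : deriv (cf1 x) = cf2 x := funext fun t => (d2 t).deriv
  have i0 : Integrable (cf x) := (int_ff hx).ofReal
  have i1 : Integrable (cf1 x) := (int_ff1 hx).ofReal
  have i2 : Integrable (cf2 x) := (int_ff2 hx).ofReal
  have a := Real.fourier_deriv i0 (fun t => (d1 t).differentiableAt) (e1 ▸ i1)
  have b := Real.fourier_deriv i1 (fun t => (d2 t).differentiableAt) (e2 ▸ i2)
  rw [e1] at a
  rw [e2, a] at b
  rw [b]
  simp only [smul_eq_mul]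
  push_cast
  linear_combination (4 * π ^ 2 * w ^ 2 * 𝓕 (cf x) w : ℂ) * Complex.I_sq

lemma int_fourier {x : ℝ} (hx : 0 < x) : Integrable (𝓕 (cf x)) := by
  have i0 : Integrable (cf x) := (int_ff hx).ofReal
  have hcont : Continuous (𝓕 (cf x)) :=
    VectorFourier.fourierIntegral_continuous Real.continuous_fourierChar continuous_inner i0
  have bd : ∀ (g : ℝ → ℂ) (w : ℝ), ‖𝓕 g w‖ ≤ ∫ t, ‖g t‖ := fun g w =>
    VectorFourier.norm_fourierIntegral_le_integral_norm _ _ _ _ _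
  refine (integrable_inv_one_add_sq.const_mul ((∫ t, ‖cf x t‖) + ∫ t, ‖cf2 x t‖)).mono'
    hcont.aestronglyMeasurable (Filter.Eventually.of_forall fun w => ?_)
  have h1 := bd (cf x) w
  have h2 := bd (cf2 x) w
  rw [fourier_cf2 hx, norm_mul, norm_neg, norm_pow, Complex.norm_real, Real.norm_eq_abs,
    sq_abs] at h2
  rw [← div_eq_mul_inv, le_div_iff₀ (by positivity)]
  have h3 : w ^ 2 ≤ (2 * π * w) ^ 2 := by
    rw [mul_pow]
    have : 1 ≤ (2 * π) ^ 2 := one_le_pow₀ (by linarith [Real.pi_gt_three])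
    nlinarith [sq_nonneg w]
  nlinarith [mul_le_mul_of_nonneg_right h3 (norm_nonneg (𝓕 (cf x) w))]

lemma fourier_cf {x : ℝ} (hx : 0 < x) (w : ℝ) :
    𝓕 (cf x) w = ((2 * Kit (2 * π * w) x : ℝ) : ℂ) := by
  have hc : Integrable fun t => ff x t * cos (2 * π * w * t) :=
    (int_ff hx).mul_bdd (c := 1) (by fun_prop)
      (Filter.Eventually.of_forall fun t => by simpa using abs_cos_le_one _)
  have hs : Integrable fun t => ff x t * sin (2 * π * w * t) :=
    (int_ff hx).mul_bdd (c := 1) (by fun_prop)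
      (Filter.Eventually.of_forall fun t => by simpa using abs_sin_le_one _)
  have h0 : ∫ t, ff x t * sin (2 * π * w * t) = 0 := integral_odd fun t => by simp [ff]
  have h1 : ∫ t, ff x t * cos (2 * π * w * t) = 2 * Kit (2 * π * w) x :=
    two_half fun t => by simp [ff]
  rw [Real.fourier_real_eq_integral_exp_smul, ← h1]
  have : ∀ t : ℝ, Complex.exp (((-2 * π * t * w : ℝ) : ℂ) * Complex.I) • cf x t
      = ((ff x t * cos (2 * π * w * t) : ℝ) : ℂ)
        - ((ff x t * sin (2 * π * w * t) : ℝ) : ℂ) * Complex.I := by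
    intro t
    rw [show -2 * π * t * w = -(2 * π * w * t) by ring, Complex.exp_mul_I,
      ← Complex.ofReal_cos, ← Complex.ofReal_sin, Real.cos_neg, Real.sin_neg, smul_eq_mul, cf]
    push_cast
    ring
  simp_rw [this]
  rw [integral_sub hc.ofReal (hs.ofReal.mul_const _), integral_mul_const,
    integral_complex_ofReal, integral_complex_ofReal, h0]
  simp

lemma scale {g : ℝ → ℝ} (h : ∀ t, g (-t) = g t) :
    ∫ w, g (2 * π * w) = π⁻¹ * ∫ t in Set.Ioi (0:ℝ), g t := by
  rw [Measure.integral_comp_mul_left g (2 * π), two_half h, abs_of_pos (by positivity), smul_eq_mul]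
  field_simp

lemma Kit_neg (τ x : ℝ) : Kit (-τ) x = Kit τ x := by
  simp [Kit]

lemma mu0_aux {x : ℝ} (hx : 0 < x) : μ 0 x = π / 4 * ∫ t, ff x t * ff x t := by
  have i0 : Integrable (cf x) := (int_ff hx).ofReal
  have hc : Continuous (cf x) := by unfold cf ff; fun_prop
  have h := parseval_even i0 i0 hc (fun t => by simp [cf, ff]) (int_fourier hx)
  simp_rw [fourier_cf hx, cf, ← Complex.ofReal_mul, integral_complex_ofReal] at h
  have h := Complex.ofReal_injective h
  have h2 := scale (g := fun τ => 2 * Kit τ x * (2 * Kit τ x)) (fun t => by simp only [Kit_neg])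
  rw [h] at h2
  have h3 : ∫ τ in Set.Ioi (0:ℝ), 2 * Kit τ x * (2 * Kit τ x) = 4 * μ 0 x := by
    rw [μ, ← integral_const_mul]
    congr 1; ext τ; ring
  rw [h2, h3]
  field_simp

lemma mu1_aux {x : ℝ} (hx : 0 < x) : μ 1 x = - (π / 4) * ∫ t, ff2 x t * ff x t := by
  have i0 : Integrable (cf x) := (int_ff hx).ofReal
  have i2 : Integrable (cf2 x) := (int_ff2 hx).ofReal
  have hc : Continuous (cf x) := by unfold cf ff; fun_prop
  have h := parseval_even i0 i2 hc (fun t => by simp [cf, ff]) (int_fourier hx)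
  simp_rw [fourier_cf2 hx, fourier_cf hx, cf, cf2, ← Complex.ofReal_pow, ← Complex.ofReal_neg,
    ← Complex.ofReal_mul, integral_complex_ofReal] at h
  have h := Complex.ofReal_injective h
  have h2 := scale (g := fun τ => -τ ^ 2 * (2 * Kit τ x) * (2 * Kit τ x))
    (fun t => by simp only [Kit_neg]; ring)
  rw [h] at h2
  have h3 : ∫ τ in Set.Ioi (0:ℝ), -τ ^ 2 * (2 * Kit τ x) * (2 * Kit τ x) = -4 * μ 1 x := by
    rw [μ, ← integral_const_mul]
    congr 1; ext τ; ring
  rw [h2, h3]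
  field_simp

lemma ff_sq (x t : ℝ) : exp (-x * cosh t) * exp (-x * cosh t) = exp (-(2 * x) * cosh t) := by
  rw [← Real.exp_add]; ring_nf

theorem mu_zero_one (x : ℝ) (hx : 0 < x) :
    μ 0 x = (Real.pi / 2) * Kre 0 (2*x) ∧
    μ 1 x = (Real.pi * x / 4) * Kre 1 (2*x) := by
  constructor
  · rw [mu0_aux hx, two_half (fun t => by simp [ff]), Kre]
    simp_rw [ff, ff_sq, zero_mul, Real.cosh_zero, mul_one]
    ring
  · have h2x : 0 < 2 * x := by positivity
    have hC : ∫ t, exp (-(2 * x) * cosh t) * cosh (1 * t) = 2 * Kre 1 (2 * x) :=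
      two_half fun t => by simp
    have ic : Integrable fun t => exp (-(2 * x) * cosh t) * cosh (1 * t) := by
      refine integrable_of_le_cosh h2x (by fun_prop) (C := 1) fun t => ?_
      rw [one_mul, one_mul, abs_of_pos (mul_pos (exp_pos _) (cosh_pos t)), mul_comm]
      gcongr
      exact cosh_le_sq t
    have is1 : Integrable fun t => sinh t * exp (-(2 * x) * cosh t) := by
      refine integrable_of_le_cosh h2x (by fun_prop) (C := 1) fun t => ?_
      rw [one_mul, abs_mul, abs_of_pos (exp_pos _)]
      gcongr
      exact (abs_sinh_le t).trans (cosh_le_sq t)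
    have is2 : Integrable fun t => sinh t ^ 2 * exp (-(2 * x) * cosh t) := by
      refine integrable_of_le_cosh h2x (by fun_prop) (C := 1) fun t => ?_
      rw [one_mul, abs_mul, abs_of_pos (exp_pos _), abs_pow]
      gcongr
      exact abs_sinh_le t
    have hz : ∫ t, (exp (-(2 * x) * cosh t) * cosh (1 * t)
        - 2 * x * (sinh t ^ 2 * exp (-(2 * x) * cosh t))) = 0 := by
      refine integral_eq_zero_of_hasDerivAt_of_integrable (fun t => ?_)
        (ic.sub (is2.const_mul (2 * x))) is1
      have := (hasDerivAt_sinh t).mul (((hasDerivAt_cosh t).const_mul (-(2 * x))).exp)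
      refine this.congr_deriv ?_
      rw [one_mul]
      ring
    rw [integral_sub ic (is2.const_mul (2 * x)), integral_const_mul, hC] at hz
    have hm : ∫ t, ff2 x t * ff x t
        = x ^ 2 * (∫ t, sinh t ^ 2 * exp (-(2 * x) * cosh t)) - x * (2 * Kre 1 (2 * x)) := by
      rw [← hC, ← integral_const_mul, ← integral_const_mul,
        ← integral_sub (is2.const_mul _) (ic.const_mul _)]
      congr 1; ext t
      rw [ff, ff2, mul_assoc, ff_sq, one_mul]
      ring
    rw [mu1_aux hx, hm]
    linear_combination (π * x / 8) * hz
end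

section
/- For real a, b, c, d > 0, (1/(4π²))·∫_0^∞ τ·sinh(πτ)·|Γ(a + iτ/2)·Γ(b + iτ/2)·Γ(c + iτ/2)·Γ(d + iτ/2)|² dτ = Γ(a+b)·Γ(a+c)·Γ(a+d)·Γ(b+c)·Γ(b+d)·Γ(c+d)/Γ(a+b+c+d) (the Wilson integral). -/
open MeasureTheory Complex

theorem wl_int_exp {ε : ℝ} (hε : 0 < ε) : Integrable (fun x : ℝ => Real.exp (-(ε * |x|))) := by
  rw [← integrableOn_univ, ← Set.Iic_union_Ioi (a := (0:ℝ)), integrableOn_union]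
  constructor
  · refine (integrableOn_exp_mul_Iic hε 0).congr_fun (fun x hx => ?_) measurableSet_Iic
    simp only [abs_of_nonpos (Set.mem_Iic.1 hx)]; ring_nf
  · refine (integrableOn_exp_mul_Ioi (a := -ε) (by linarith) 0).congr_fun (fun x hx => ?_)
      measurableSet_Ioi
    simp only [abs_of_pos (Set.mem_Ioi.1 hx)]; ring_nf

theorem wl_shift (f : ℂ → ℂ) (C ε : ℝ) (hε : 0 < ε)
    (hf : ∀ z : ℂ, |z.re| ≤ 1/2 → DifferentiableAt ℂ f z)
    (hb : ∀ z : ℂ, |z.re| ≤ 1/2 → ‖f z‖ ≤ C * Real.exp (-(ε * |z.im|))) :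
    Integrable (fun y : ℝ => f (((1/2 : ℝ) : ℂ) + y * I)) ∧
    Integrable (fun y : ℝ => f (((-(1/2) : ℝ) : ℂ) + y * I)) ∧
    ∫ y : ℝ, f (((1/2 : ℝ) : ℂ) + y * I) = ∫ y : ℝ, f (((-(1/2) : ℝ) : ℂ) + y * I) := by
  have hi : ∀ x : ℝ, |x| ≤ 1/2 → Integrable (fun y : ℝ => f ((x : ℂ) + y * I)) := by
    intro x hx
    refine ((wl_int_exp hε).const_mul C).mono' ?_ (Filter.Eventually.of_forall fun y => ?_)
    · refine Continuous.aestronglyMeasurable ?_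
      rw [continuous_iff_continuousAt]
      intro y
      have h1 : ContinuousAt f ((x : ℂ) + y * I) := (hf _ (by simpa using hx)).continuousAt
      exact ContinuousAt.comp (f := fun y : ℝ => (x : ℂ) + y * I) h1 (by fun_prop)
    · simpa using hb ((x : ℂ) + y * I) (by simpa using hx)
  have h1 := hi (1/2) (by rw [abs_of_pos] <;> norm_num)
  have h2 := hi (-(1/2)) (by rw [abs_neg, abs_of_pos] <;> norm_num)
  refine ⟨h1, h2, ?_⟩
  have hN : Filter.Tendsto (fun T : ℝ => T) Filter.atTop Filter.atTop := Filter.tendsto_id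
  have t1 := intervalIntegral_tendsto_integral h1 Filter.tendsto_neg_atTop_atBot hN
  have t2 := intervalIntegral_tendsto_integral h2 Filter.tendsto_neg_atTop_atBot hN
  have te : Filter.Tendsto (fun T : ℝ => 2 * (C * Real.exp (-(ε * |T|)))) Filter.atTop (nhds 0) := by
    have : Filter.Tendsto (fun T : ℝ => Real.exp (-(ε * |T|))) Filter.atTop (nhds 0) := by
      apply Real.tendsto_exp_neg_atTop_nhds_zero.comp
      exact Filter.Tendsto.const_mul_atTop hε Filter.tendsto_abs_atTop_atTop
    simpa using (this.const_mul C).const_mul 2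
  have key : ∀ T : ℝ, ‖(∫ y in (-T)..T, f (((1/2 : ℝ) : ℂ) + y * I)) -
      ∫ y in (-T)..T, f (((-(1/2) : ℝ) : ℂ) + y * I)‖ ≤ 2 * (C * Real.exp (-(ε * |T|))) := by
    intro T
    have hrect := integral_boundary_rect_eq_zero_of_differentiableOn f
      (⟨-(1/2), -T⟩ : ℂ) (⟨1/2, T⟩ : ℂ) (by
        intro z hz
        refine (hf z ?_).differentiableWithinAt
        have := hz.1
        simp only [Set.mem_preimage] at this
        rw [Set.uIcc_of_le (by norm_num)] at this
        exact abs_le.2 this)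
    simp only [smul_eq_mul] at hrect
    have hor : ∀ S : ℝ, |S| = |T| →
        ‖∫ x in (-(1/2) : ℝ)..(1/2), f ((x : ℂ) + S * I)‖ ≤ C * Real.exp (-(ε * |T|)) := by
      intro S hS
      have := intervalIntegral.norm_integral_le_of_norm_le_const (a := (-(1/2) : ℝ)) (b := 1/2)
        (f := fun x : ℝ => f ((x : ℂ) + S * I)) (C := C * Real.exp (-(ε * |T|))) (by
          intro x hx
          rw [Set.uIoc_of_le (by norm_num)] at hx
          have := hb ((x : ℂ) + S * I) (by simpa using abs_le.2 ⟨hx.1.le, hx.2⟩)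
          simpa [hS] using this)
      norm_num at this ⊢
      exact this
    have e1 := hor T rfl
    have e2 := hor (-T) (abs_neg T)
    set A := ∫ y in (-T)..T, f (((1/2 : ℝ) : ℂ) + y * I)
    set B := ∫ y in (-T)..T, f (((-(1/2) : ℝ) : ℂ) + y * I)
    set U := ∫ x in (-(1/2) : ℝ)..(1/2), f ((x : ℂ) + T * I)
    set V := ∫ x in (-(1/2) : ℝ)..(1/2), f ((x : ℂ) + ((-T : ℝ) : ℂ) * I)
    have : I * (A - B) = U - V := by linear_combination hrect
    calc ‖A - B‖ = ‖I * (A - B)‖ := by simp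
      _ = ‖U - V‖ := by rw [this]
      _ ≤ ‖U‖ + ‖V‖ := norm_sub_le _ _
      _ ≤ _ := by linarith
  have t0 := squeeze_zero_norm key te
  exact sub_eq_zero.1 (tendsto_nhds_unique (t1.sub t2) t0)

theorem wl_norm_Gamma_le (s : ℂ) (hs : 0 < s.re) : ‖Gamma s‖ ≤ Real.Gamma s.re := by
  rw [Complex.Gamma_eq_integral hs, Real.Gamma_eq_integral hs, Complex.GammaIntegral]
  refine (norm_integral_le_integral_norm _).trans (le_of_eq ?_)
  refine setIntegral_congr_fun measurableSet_Ioi (fun x hx => ?_)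
  simp only [norm_mul]
  rw [norm_cpow_eq_rpow_re_of_pos hx, norm_real, Real.norm_of_nonneg (Real.exp_nonneg _)]
  simp

theorem wl_beta (s : ℂ) (w : ℝ) (hs : 0 < s.re) (hw : 0 < w) :
    ‖betaIntegral s w‖ ≤ ‖betaIntegral (s.re : ℂ) w‖ := by
  have hE : betaIntegral (s.re : ℂ) w =
      ((∫ x in (0:ℝ)..1, x ^ (s.re - 1) * (1 - x) ^ (w - 1) : ℝ) : ℂ) := by
    rw [betaIntegral, ← intervalIntegral.integral_ofReal]
    refine intervalIntegral.integral_congr (fun x hx => ?_)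
    rw [Set.uIcc_of_le zero_le_one] at hx
    rw [ofReal_mul, ofReal_cpow hx.1, ofReal_cpow (by linarith [hx.2])]
    simp
  rw [hE, norm_real, betaIntegral]
  refine le_trans ?_ (Real.le_norm_self _)
  refine (intervalIntegral.norm_integral_le_integral_norm zero_le_one).trans (le_of_eq ?_)
  rw [intervalIntegral.integral_of_le zero_le_one, intervalIntegral.integral_of_le zero_le_one,
    integral_Ioc_eq_integral_Ioo, integral_Ioc_eq_integral_Ioo]
  refine setIntegral_congr_fun measurableSet_Ioo (fun x hx => ?_)
  simp only [norm_mul]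
  rw [norm_cpow_eq_rpow_re_of_pos hx.1]
  have : (1 - (x:ℂ)) = ((1 - x : ℝ) : ℂ) := by simp
  rw [this, norm_cpow_eq_rpow_re_of_pos (by linarith [hx.2])]
  simp

theorem wl_mono (s : ℂ) (w : ℝ) (hs : 0 < s.re) (hw : 0 < w) :
    ‖Gamma s‖ ≤ Real.Gamma s.re / Real.Gamma (s.re + w) * ‖Gamma (s + w)‖ := by
  have h1 := Complex.Gamma_mul_Gamma_eq_betaIntegral hs (t := (w : ℂ)) (by simpa using hw)
  have h2 := Complex.Gamma_mul_Gamma_eq_betaIntegral (s := (s.re : ℂ)) (by simpa using hs)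
    (t := (w : ℂ)) (by simpa using hw)
  have h1' := congrArg norm h1
  have h2' := congrArg norm h2
  rw [← ofReal_add] at h2'
  simp only [norm_mul, Gamma_ofReal, norm_real] at h1' h2'
  have p1 := Real.Gamma_pos_of_pos hs
  have p2 := Real.Gamma_pos_of_pos hw
  have p3 := Real.Gamma_pos_of_pos (add_pos hs hw)
  rw [Real.norm_of_nonneg p1.le, Real.norm_of_nonneg p2.le, Real.norm_of_nonneg p3.le] at h2'
  rw [Real.norm_of_nonneg p2.le] at h1'
  have hb := wl_beta s w hs hw
  have hB : ‖betaIntegral (s.re : ℂ) w‖ =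
    Real.Gamma s.re * Real.Gamma w / Real.Gamma (s.re + w) := by
    rw [h2']; field_simp
  have := mul_le_mul_of_nonneg_left hb (norm_nonneg (Gamma (s + w)))
  rw [← h1', hB] at this
  refine le_of_mul_le_mul_right (this.trans (le_of_eq ?_)) p2
  field_simp

theorem wl_half (y : ℝ) : normSq (Gamma ((1/2 : ℝ) + y * I)) = Real.pi / Real.cosh (Real.pi * y) := by
  have h := Complex.Gamma_mul_Gamma_one_sub ((1/2 : ℝ) + y * I)
  have hc : (1 : ℂ) - (((1/2 : ℝ) : ℂ) + y * I) = (starRingEnd ℂ) ((1/2 : ℝ) + y * I) := by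
    apply Complex.ext <;> simp; norm_num
  rw [hc, Gamma_conj, mul_conj] at h
  have hs : Complex.sin (Real.pi * ((1/2 : ℝ) + y * I)) = ((Real.cosh (Real.pi * y) : ℝ) : ℂ) := by
    have : (Real.pi : ℂ) * (((1/2 : ℝ) : ℂ) + y * I) = (Real.pi * y : ℝ) * I + Real.pi / 2 := by
      push_cast; ring
    rw [this, Complex.sin_add_pi_div_two, Complex.cos_mul_I, Complex.ofReal_cosh]
  rw [hs] at h
  exact_mod_cast h

theorem wl_half_le (y : ℝ) : ‖Gamma ((1/2 : ℝ) + y * I)‖ ≤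
    Real.sqrt (2 * Real.pi) * Real.exp (-(Real.pi / 2 * |y|)) := by
  rw [← Real.sqrt_sq (norm_nonneg _), ← Real.sqrt_sq (Real.exp_nonneg (-(Real.pi / 2 * |y|))),
    ← Real.sqrt_mul (by positivity)]
  apply Real.sqrt_le_sqrt
  rw [← normSq_eq_norm_sq, wl_half, ← Real.cosh_abs, Real.cosh_eq, abs_mul,
    abs_of_pos Real.pi_pos, ← Real.exp_nat_mul]
  have e : ((2:ℕ):ℝ) * -(Real.pi / 2 * |y|) = -(Real.pi * |y|) := by push_cast; ring
  rw [e, Real.exp_neg, div_le_iff₀ (by positivity)]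
  have : 0 < Real.exp (Real.pi * |y|) := Real.exp_pos _
  field_simp
  have := Real.pi_pos
  nlinarith [sq_nonneg (Real.exp (Real.pi * |y|))]

theorem wl_half_nat (m : ℕ) : ∃ C : ℝ, 0 ≤ C ∧ ∀ y : ℝ, ‖Gamma (((m + 1/2 : ℝ) : ℂ) + y * I)‖ ≤
    C * (1 + |y|)^m * Real.exp (-(Real.pi / 2 * |y|)) := by
  induction m with
  | zero => exact ⟨Real.sqrt (2 * Real.pi), Real.sqrt_nonneg _, fun y => by
      simpa using wl_half_le y⟩
  | succ m ih =>
    obtain ⟨C, hC, h⟩ := ih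
    refine ⟨(m + 1) * C, by positivity, fun y => ?_⟩
    have e : (((m + 1 : ℕ) + 1/2 : ℝ) : ℂ) + y * I = (((m + 1/2 : ℝ) : ℂ) + y * I) + 1 := by
      push_cast; ring
    have hne : ((m + 1/2 : ℝ) : ℂ) + y * I ≠ 0 := by
      intro h0
      have := congrArg re h0
      simp at this
      have hm : (0:ℝ) ≤ m := Nat.cast_nonneg m
      linarith
    rw [e, Gamma_add_one _ hne, norm_mul]
    have hn : ‖((m + 1/2 : ℝ) : ℂ) + y * I‖ ≤ (m + 1) * (1 + |y|) := by
      refine (norm_add_le _ _).trans ?_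
      have hm : (0:ℝ) ≤ m := Nat.cast_nonneg m
      rw [norm_mul, norm_I, norm_real, norm_real, Real.norm_of_nonneg (by positivity), Real.norm_eq_abs]
      nlinarith [abs_nonneg y, mul_nonneg hm (abs_nonneg y)]
    calc _ ≤ ((m + 1) * (1 + |y|)) * (C * (1 + |y|)^m * Real.exp (-(Real.pi / 2 * |y|))) :=
          mul_le_mul hn (h y) (norm_nonneg _) (by positivity)
      _ = _ := by ring

theorem wl_poly (m : ℕ) : ∃ C : ℝ, 0 ≤ C ∧ ∀ t : ℝ, 0 ≤ t →
    (1 + t)^m ≤ C * Real.exp (Real.pi / 12 * t) := by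
  refine ⟨(12 / Real.pi) ^ m * m.factorial * Real.exp (Real.pi / 12), by positivity, fun t ht => ?_⟩
  have := Real.pow_div_factorial_le_exp (Real.pi / 12 * (1 + t)) (by positivity) m
  rw [mul_pow, div_le_iff₀ (by positivity)] at this
  have e : Real.exp (Real.pi / 12 * (1 + t)) =
    Real.exp (Real.pi / 12) * Real.exp (Real.pi / 12 * t) := by rw [← Real.exp_add]; ring_nf
  rw [e] at this
  have h2 := mul_le_mul_of_nonneg_left this (show (0:ℝ) ≤ (12 / Real.pi)^m by positivity)
  rw [← mul_assoc, ← mul_pow] at h2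
  have e2 : 12 / Real.pi * (Real.pi / 12) = 1 := by field_simp
  rw [e2, one_pow, one_mul] at h2
  linarith

theorem wl_bound (l M : ℝ) (hl : 0 < l) : ∃ C : ℝ, 0 ≤ C ∧ ∀ s : ℂ, l ≤ s.re → s.re ≤ M →
    ‖Gamma s‖ ≤ C * Real.exp (-(5 * Real.pi / 12 * |s.im|)) := by
  obtain ⟨m, hm⟩ := exists_nat_gt M
  obtain ⟨C1, hC1, h1⟩ := wl_half_nat m
  obtain ⟨C2, hC2, h2⟩ := wl_poly m
  obtain ⟨B, hB⟩ : ∃ B : ℝ, ∀ x ∈ Set.Icc l M, Real.Gamma x ≤ B := by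
    have : ContinuousOn Real.Gamma (Set.Icc l M) := fun x hx =>
      (Real.differentiableAt_Gamma (fun k => by
        have : (0:ℝ) ≤ k := Nat.cast_nonneg k
        have := hx.1
        linarith)).continuousAt.continuousWithinAt
    obtain ⟨B, hB⟩ := isCompact_Icc.bddAbove_image this
    exact ⟨B, fun x hx => hB (Set.mem_image_of_mem _ hx)⟩
  have hG : 0 < Real.Gamma (m + 1/2) := Real.Gamma_pos_of_pos (by positivity)
  refine ⟨max B 0 / Real.Gamma (m + 1/2) * (C1 * C2), by positivity, fun s hs hsM => ?_⟩
  have h3 := wl_mono s (m + 1/2 - s.re) (by linarith) (by linarith)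
  have e1 : s.re + (m + 1/2 - s.re) = m + 1/2 := by ring
  have e2 : s + ((m + 1/2 - s.re : ℝ) : ℂ) = ((m + 1/2 : ℝ) : ℂ) + s.im * I := by
    apply Complex.ext <;> simp
  rw [e1, e2] at h3
  have e3 : Real.exp (-(5 * Real.pi / 12 * |s.im|)) =
    Real.exp (Real.pi / 12 * |s.im|) * Real.exp (-(Real.pi / 2 * |s.im|)) := by
    rw [← Real.exp_add]; ring_nf
  have h4 : ‖Gamma (((m + 1/2 : ℝ) : ℂ) + s.im * I)‖ ≤
      C1 * C2 * Real.exp (-(5 * Real.pi / 12 * |s.im|)) := by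
    refine (h1 s.im).trans ?_
    rw [e3]
    have := h2 |s.im| (abs_nonneg _)
    calc _ ≤ C1 * (C2 * Real.exp (Real.pi / 12 * |s.im|)) * Real.exp (-(Real.pi / 2 * |s.im|)) := by
          gcongr
      _ = _ := by ring
  calc _ ≤ _ := h3
    _ ≤ max B 0 / Real.Gamma (m + 1/2) * (C1 * C2 * Real.exp (-(5 * Real.pi / 12 * |s.im|))) := by
        gcongr
        exact (hB _ ⟨hs, hsM⟩).trans (le_max_left _ _)
    _ = _ := by ring

noncomputable def wN (e τ : ℝ) : ℝ := normSq (Gamma (e + τ/2 * I))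

theorem wl_ne {e : ℝ} (he : 0 < e) (y : ℂ) (hy : y.re = 0) (m : ℕ) : (e : ℂ) + y ≠ -m := by
  intro h0
  have := congrArg re h0
  simp [hy] at this
  have hm : (0:ℝ) ≤ m := Nat.cast_nonneg m
  linarith

theorem wN_cont {e : ℝ} (he : 0 < e) : Continuous (wN e) := by
  unfold wN
  refine continuous_normSq.comp ?_
  rw [continuous_iff_continuousAt]
  intro τ
  refine ContinuousAt.comp (f := fun τ : ℝ => (e : ℂ) + τ/2 * I) (g := Gamma)
    (differentiableAt_Gamma _ (wl_ne he _ ?_)).continuousAt (by fun_prop)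
  simp

theorem wN_nonneg (e τ : ℝ) : 0 ≤ wN e τ := normSq_nonneg _

theorem wN_eq (e τ : ℝ) : ((wN e τ : ℝ) : ℂ) = Gamma (e + τ/2 * I) * Gamma (e - τ/2 * I) := by
  unfold wN
  rw [← mul_conj, ← Gamma_conj]
  congr 2
  rw [show (τ : ℂ) / 2 = ((τ / 2 : ℝ) : ℂ) by push_cast; rfl]
  rw [map_add, map_mul, conj_ofReal, conj_ofReal, conj_I]
  ring

theorem wN_even (e τ : ℝ) : wN e (-τ) = wN e τ := by
  have : ((wN e (-τ) : ℝ) : ℂ) = wN e τ := by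
    rw [wN_eq, wN_eq, mul_comm]; push_cast; ring_nf
  exact_mod_cast this

theorem wN_abs (e τ : ℝ) : wN e |τ| = wN e τ := by
  rcases abs_choice τ with h | h <;> rw [h]
  exact wN_even e τ

theorem wN_succ {e : ℝ} (he : 0 < e) (τ : ℝ) : wN (e + 1) τ = (e^2 + τ^2/4) * wN e τ := by
  unfold wN
  have h : (((e + 1 : ℝ) : ℂ) + τ/2 * I) = ((e : ℂ) + τ/2 * I) + 1 := by push_cast; ring
  have hne := wl_ne he ((τ:ℂ)/2 * I) (by simp) 0
  rw [h, Gamma_add_one _ (by simpa using hne), map_mul]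
  congr 1
  simp [normSq_apply]; ring

theorem wN_le {e : ℝ} (he : 0 < e) (τ : ℝ) : wN e τ ≤ Real.Gamma e ^ 2 := by
  unfold wN
  rw [normSq_eq_norm_sq]
  have := wl_norm_Gamma_le ((e : ℂ) + τ/2 * I) (by simpa using he)
  have e1 : ((e : ℂ) + τ/2 * I).re = e := by simp
  rw [e1] at this
  gcongr

theorem wN_decay {e : ℝ} (he : 0 < e) : ∃ C : ℝ, 0 ≤ C ∧ ∀ τ,
    wN e τ ≤ C * Real.exp (-(5 * Real.pi / 12 * |τ|)) := by
  obtain ⟨C, hC, h⟩ := wl_bound e e he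
  refine ⟨C^2, by positivity, fun τ => ?_⟩
  have h1 := h ((e : ℂ) + τ/2 * I) (by simp) (by simp)
  have e1 : ((e : ℂ) + τ/2 * I).im = τ/2 := by simp
  rw [e1] at h1
  unfold wN
  rw [normSq_eq_norm_sq]
  calc _ ≤ (C * Real.exp (-(5 * Real.pi / 12 * |τ/2|)))^2 := by gcongr
    _ = _ := by
      rw [mul_pow, ← Real.exp_nat_mul, abs_div, abs_two]; push_cast; ring_nf

noncomputable def wV (b c d τ : ℝ) : ℝ :=
  τ * Real.sinh (Real.pi * τ) * (wN b τ * wN c τ * wN d τ)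

theorem wV_cont {b c d : ℝ} (hb : 0 < b) (hc : 0 < c) (hd : 0 < d) : Continuous (wV b c d) := by
  unfold wV
  have := wN_cont hb
  have := wN_cont hc
  have := wN_cont hd
  have := Real.continuous_sinh
  fun_prop

theorem wV_int {b c d : ℝ} (hb : 0 < b) (hc : 0 < c) (hd : 0 < d) :
    IntegrableOn (wV b c d) (Set.Ioi 0) := by
  obtain ⟨B, hB, h1⟩ := wN_decay hb
  obtain ⟨C, hC, h2⟩ := wN_decay hc
  obtain ⟨D, hD, h3⟩ := wN_decay hd
  obtain ⟨P, hP, h4⟩ := wl_poly 1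
  refine Integrable.mono' (((integrableOn_exp_mul_Ioi (a := -(Real.pi / 6))
    (by linarith [Real.pi_pos]) 0).const_mul (P * (B * C * D)))) 
    (wV_cont hb hc hd).aestronglyMeasurable ?_
  refine (ae_restrict_iff' measurableSet_Ioi).2 (Filter.Eventually.of_forall fun τ hτ => ?_)
  have hτ : 0 < τ := hτ
  have p1 : τ ≤ P * Real.exp (Real.pi / 12 * τ) := by
    have := h4 τ hτ.le
    rw [pow_one] at this
    linarith
  have p2 : Real.sinh (Real.pi * τ) ≤ Real.exp (Real.pi * τ) := by
    rw [Real.sinh_eq]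
    have := Real.exp_pos (Real.pi * τ)
    have := Real.exp_pos (-(Real.pi * τ))
    linarith
  have p0 : 0 ≤ Real.sinh (Real.pi * τ) := Real.sinh_nonneg_iff.2 (by have := Real.pi_pos; positivity)
  have q1 := h1 τ
  have q2 := h2 τ
  have q3 := h3 τ
  rw [abs_of_pos hτ] at q1 q2 q3
  have n1 := wN_nonneg b τ
  have n2 := wN_nonneg c τ
  have n3 := wN_nonneg d τ
  unfold wV
  rw [Real.norm_of_nonneg (by positivity)]
  calc _ ≤ (P * Real.exp (Real.pi / 12 * τ)) * Real.exp (Real.pi * τ) *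
        ((B * Real.exp (-(5 * Real.pi / 12 * τ))) * (C * Real.exp (-(5 * Real.pi / 12 * τ))) *
        (D * Real.exp (-(5 * Real.pi / 12 * τ)))) := by gcongr
    _ = P * (B * C * D) * (Real.exp (Real.pi / 12 * τ) * Real.exp (Real.pi * τ) *
        Real.exp (-(5 * Real.pi / 12 * τ)) * Real.exp (-(5 * Real.pi / 12 * τ)) *
        Real.exp (-(5 * Real.pi / 12 * τ))) := by ring
    _ = _ := by
      rw [← Real.exp_add, ← Real.exp_add, ← Real.exp_add, ← Real.exp_add]
      congr 2; ring

theorem wVN_int {a b c d : ℝ} (ha : 0 < a) (hb : 0 < b) (hc : 0 < c) (hd : 0 < d) :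
    IntegrableOn (fun τ => wN a τ * wV b c d τ) (Set.Ioi 0) := by
  refine Integrable.mono' ((wV_int hb hc hd).norm.const_mul (Real.Gamma a ^ 2))
    ((wN_cont ha).mul (wV_cont hb hc hd)).aestronglyMeasurable
    (Filter.Eventually.of_forall fun τ => ?_)
  rw [norm_mul, Real.norm_of_nonneg (wN_nonneg a τ)]
  exact mul_le_mul_of_nonneg_right (wN_le ha τ) (norm_nonneg _)

noncomputable def wI (a b c d : ℝ) : ℝ := ∫ τ in Set.Ioi (0:ℝ), wN a τ * wV b c d τ

theorem wI_swap (a b c d : ℝ) : wI a b c d = wI b a c d := by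
  unfold wI wV; congr 1; ext τ; ring

theorem wI_rot (a b c d : ℝ) : wI a b c d = wI b c d a := by
  unfold wI wV; congr 1; ext τ; ring

/-- The function whose contour is shifted. -/
noncomputable def wG (e : ℝ) (z : ℂ) : ℂ := Gamma ((e + 1/2 : ℝ) + z) * Gamma ((e + 1/2 : ℝ) - z)

theorem wG_diff {e : ℝ} (he : 0 < e) (z : ℂ) (hz : |z.re| ≤ 1/2) : DifferentiableAt ℂ (wG e) z := by
  have hz := abs_le.1 hz
  unfold wG
  have h1 : DifferentiableAt ℂ Gamma (((e + 1/2 : ℝ) : ℂ) + z) := by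
    refine differentiableAt_Gamma _ (fun m h => ?_)
    have := congrArg re h
    simp at this
    have hm : (0:ℝ) ≤ m := Nat.cast_nonneg m
    linarith
  have h2 : DifferentiableAt ℂ Gamma (((e + 1/2 : ℝ) : ℂ) - z) := by
    refine differentiableAt_Gamma _ (fun m h => ?_)
    have := congrArg re h
    simp at this
    have hm : (0:ℝ) ≤ m := Nat.cast_nonneg m
    linarith
  exact (DifferentiableAt.comp (f := fun z => ((e + 1/2 : ℝ) : ℂ) + z) z h1 (by fun_prop)).mul
    (DifferentiableAt.comp (f := fun z => ((e + 1/2 : ℝ) : ℂ) - z) z h2 (by fun_prop))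

theorem wG_bound {e : ℝ} (he : 0 < e) : ∃ C : ℝ, 0 ≤ C ∧ ∀ z : ℂ, |z.re| ≤ 1/2 →
    ‖wG e z‖ ≤ C * Real.exp (-(5 * Real.pi / 6 * |z.im|)) := by
  obtain ⟨C, hC, h⟩ := wl_bound e (e + 1) he
  refine ⟨C^2, by positivity, fun z hz => ?_⟩
  have hz := abs_le.1 hz
  have h1 := h (((e + 1/2 : ℝ) : ℂ) + z) (by simp; linarith) (by simp; linarith)
  have h2 := h (((e + 1/2 : ℝ) : ℂ) - z) (by simp; linarith) (by simp; linarith)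
  have i1 : (((e + 1/2 : ℝ) : ℂ) + z).im = z.im := by simp
  have i2 : (((e + 1/2 : ℝ) : ℂ) - z).im = -z.im := by simp
  rw [i1] at h1
  rw [i2, abs_neg] at h2
  unfold wG
  rw [norm_mul]
  calc _ ≤ _ := mul_le_mul h1 h2 (norm_nonneg _) (by positivity)
    _ = C^2 * (Real.exp (-(5 * Real.pi / 12 * |z.im|)) * Real.exp (-(5 * Real.pi / 12 * |z.im|))) := by
      ring
    _ = _ := by rw [← Real.exp_add]; ring_nf

theorem wl_sin (z : ℂ) : ‖Complex.sin (2 * Real.pi * z)‖ ≤ Real.exp (2 * Real.pi * |z.im|) := by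
  have key : ∀ w : ℂ, ‖Complex.sin w‖ ≤ Real.exp |w.im| := by
    intro w
    rw [Complex.sin, norm_div, norm_mul, norm_I]
    have h := norm_sub_le (cexp (-w * I)) (cexp (w * I))
    rw [norm_exp, norm_exp] at h
    have a1 : Real.exp ((-w * I).re) ≤ Real.exp |w.im| := by
      apply Real.exp_le_exp.2; simpa using le_abs_self _
    have a2 : Real.exp ((w * I).re) ≤ Real.exp |w.im| := by
      apply Real.exp_le_exp.2; simpa using neg_le_abs _
    simp only [mul_one, Complex.norm_ofNat]
    linarith
  refine (key _).trans (le_of_eq ?_)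
  have : (2 * Real.pi * z : ℂ).im = 2 * Real.pi * z.im := by
    have : (2 * Real.pi * z : ℂ) = ((2 * Real.pi : ℝ) : ℂ) * z := by push_cast; ring
    rw [this, im_ofReal_mul]
  rw [this, abs_mul, abs_of_pos (by have := Real.pi_pos; positivity)]

theorem wG_plus {e : ℝ} (he : 0 < e) (y : ℝ) : wG e (((1/2 : ℝ) : ℂ) + y * I) =
    (e + y * I) * wN e (2 * y) := by
  rw [wN_eq]
  unfold wG
  have e1 : ((e + 1/2 : ℝ) : ℂ) + (((1/2 : ℝ) : ℂ) + y * I) = (e + y * I) + 1 := by push_cast; ring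
  have e2 : ((e + 1/2 : ℝ) : ℂ) - (((1/2 : ℝ) : ℂ) + y * I) = e - y * I := by push_cast; ring
  have hne := wl_ne he ((y:ℂ) * I) (by simp) 0
  rw [e1, e2, Gamma_add_one _ (by simpa using hne)]
  push_cast
  ring_nf

theorem wG_minus {e : ℝ} (he : 0 < e) (y : ℝ) : wG e (((-(1/2) : ℝ) : ℂ) + y * I) =
    (e - y * I) * wN e (2 * y) := by
  rw [wN_eq]
  unfold wG
  have e1 : ((e + 1/2 : ℝ) : ℂ) + (((-(1/2) : ℝ) : ℂ) + y * I) = e + y * I := by push_cast; ring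
  have e2 : ((e + 1/2 : ℝ) : ℂ) - (((-(1/2) : ℝ) : ℂ) + y * I) = (e + (-(y * I))) + 1 := by
    push_cast; ring
  have hne := wl_ne he (-((y:ℂ) * I)) (by simp) 0
  rw [e1, e2, Gamma_add_one _ (by simpa using hne)]
  push_cast
  ring_nf

theorem wl_sin_plus (y : ℝ) : Complex.sin (2 * Real.pi * (((1/2 : ℝ) : ℂ) + y * I)) =
    - (Real.sinh (2 * Real.pi * y) : ℝ) * I := by
  have : 2 * Real.pi * (((1/2 : ℝ) : ℂ) + y * I) = ((2 * Real.pi * y : ℝ) : ℂ) * I + Real.pi := by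
    push_cast; ring
  rw [this, Complex.sin_add_pi, Complex.sin_mul_I, ofReal_sinh]; ring

theorem wl_sin_minus (y : ℝ) : Complex.sin (2 * Real.pi * (((-(1/2) : ℝ) : ℂ) + y * I)) =
    - (Real.sinh (2 * Real.pi * y) : ℝ) * I := by
  have : 2 * Real.pi * (((-(1/2) : ℝ) : ℂ) + y * I) = ((2 * Real.pi * y : ℝ) : ℂ) * I - Real.pi := by
    push_cast; ring
  rw [this, Complex.sin_sub_pi, Complex.sin_mul_I, ofReal_sinh]; ring

theorem wl_zero {a b c d : ℝ} (ha : 0 < a) (hb : 0 < b) (hc : 0 < c) (hd : 0 < d) :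
    ∫ τ in Set.Ioi (0:ℝ), (a*b*c + a*b*d + a*c*d + b*c*d - (a+b+c+d) * (τ^2/4)) *
      (wN a τ * wV b c d τ) = 0 := by
  obtain ⟨A, hA, h1⟩ := wG_bound ha
  obtain ⟨B, hB, h2⟩ := wG_bound hb
  obtain ⟨C, hC, h3⟩ := wG_bound hc
  obtain ⟨D, hD, h4⟩ := wG_bound hd
  have hpi := Real.pi_pos
  obtain ⟨i1, i2, hs⟩ := wl_shift
    (fun z => Complex.sin (2 * Real.pi * z) * (wG a z * wG b z * (wG c z * wG d z)))
    (A * B * (C * D)) (4 * Real.pi / 3) (by positivity)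
    (fun z hz => by
      have d1 := wG_diff ha z hz
      have d2 := wG_diff hb z hz
      have d3 := wG_diff hc z hz
      have d4 := wG_diff hd z hz
      have d5 : DifferentiableAt ℂ (fun z => Complex.sin (2 * Real.pi * z)) z := by fun_prop
      exact d5.mul ((d1.mul d2).mul (d3.mul d4)))
    (fun z hz => by
      simp only [norm_mul]
      have b0 := wl_sin z
      have b1 := h1 z hz
      have b2 := h2 z hz
      have b3 := h3 z hz
      have b4 := h4 z hz
      set E := Real.exp (-(5 * Real.pi / 6 * |z.im|)) with hE
      have hEp : 0 < E := Real.exp_pos _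
      calc _ ≤ Real.exp (2 * Real.pi * |z.im|) * ((A * E) * (B * E) * ((C * E) * (D * E))) := by
            gcongr
        _ = A * B * (C * D) * (Real.exp (2 * Real.pi * |z.im|) * E * E * E * E) := by ring
        _ = _ := by
          rw [hE, ← Real.exp_add, ← Real.exp_add, ← Real.exp_add, ← Real.exp_add]
          congr 2; ring)
  have hs' := sub_eq_zero.2 hs
  rw [← integral_sub i1 i2] at hs'
  set F : ℝ → ℝ := fun τ => (a*b*c + a*b*d + a*c*d + b*c*d - (a+b+c+d) * (τ^2/4)) *
      (wN a τ * wV b c d τ) with hF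
  have hFF : ∀ y : ℝ, Complex.sin (2 * Real.pi * (((1/2 : ℝ) : ℂ) + y * I)) *
      (wG a (((1/2 : ℝ) : ℂ) + y * I) * wG b (((1/2 : ℝ) : ℂ) + y * I) *
      (wG c (((1/2 : ℝ) : ℂ) + y * I) * wG d (((1/2 : ℝ) : ℂ) + y * I))) -
      Complex.sin (2 * Real.pi * (((-(1/2) : ℝ) : ℂ) + y * I)) *
      (wG a (((-(1/2) : ℝ) : ℂ) + y * I) * wG b (((-(1/2) : ℝ) : ℂ) + y * I) *
      (wG c (((-(1/2) : ℝ) : ℂ) + y * I) * wG d (((-(1/2) : ℝ) : ℂ) + y * I))) =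
      ((F (y * 2) : ℝ) : ℂ) := by
    intro y
    rw [wG_plus ha, wG_plus hb, wG_plus hc, wG_plus hd, wG_minus ha, wG_minus hb, wG_minus hc,
      wG_minus hd, wl_sin_plus, wl_sin_minus, hF]
    simp only [wV]
    have e1 : Real.pi * (y * 2) = 2 * Real.pi * y := by ring
    have e2 : y * 2 = 2 * y := by ring
    rw [e1, e2]
    generalize Real.sinh (2 * Real.pi * y) = S
    generalize wN a (2 * y) = n1
    generalize wN b (2 * y) = n2
    generalize wN c (2 * y) = n3
    generalize wN d (2 * y) = n4
    push_cast
    have hI : (I : ℂ)^2 = -1 := I_sq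
    have hI4 : (I : ℂ)^4 = 1 := I_pow_four
    ring_nf
    simp only [hI, hI4]
    ring
  have h0 : ∫ y : ℝ, F (y * 2) = 0 := by
    have : ((∫ y : ℝ, F (y * 2) : ℝ) : ℂ) = 0 := by
      rw [← hs', ← integral_complex_ofReal]
      refine integral_congr_ae (Filter.Eventually.of_forall fun y => ?_)
      exact (hFF y).symm
    exact_mod_cast this
  rw [Measure.integral_comp_mul_right] at h0
  have hev : ∀ τ, F |τ| = F τ := by
    intro τ
    simp only [hF, wV, wN_abs, sq_abs]
    rcases abs_choice τ with h | h <;> rw [h]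
    rw [mul_neg, Real.sinh_neg]
    ring
  have h5 := integral_comp_abs (f := F)
  simp only [hev] at h5
  rw [h5] at h0
  simpa using h0

theorem wI_rec {a b c d : ℝ} (ha : 0 < a) (hb : 0 < b) (hc : 0 < c) (hd : 0 < d) :
    (a + b + c + d) * wI (a + 1) b c d = (a + b) * (a + c) * (a + d) * wI a b c d := by
  have h0 := wl_zero ha hb hc hd
  have j1 := wVN_int ha hb hc hd
  have j2 := wVN_int (show 0 < a + 1 by linarith) hb hc hd
  have : ∀ τ, (a*b*c + a*b*d + a*c*d + b*c*d - (a+b+c+d) * (τ^2/4)) * (wN a τ * wV b c d τ) =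
      ((a + b) * (a + c) * (a + d)) * (wN a τ * wV b c d τ) -
      (a + b + c + d) * (wN (a + 1) τ * wV b c d τ) := by
    intro τ; rw [wN_succ ha]; ring
  simp only [this] at h0
  rw [integral_sub (j1.const_mul _) (j2.const_mul _), integral_const_mul, integral_const_mul] at h0
  unfold wI
  linarith

noncomputable def wR (a b c d : ℝ) : ℝ :=
  Real.Gamma (a+b) * Real.Gamma (a+c) * Real.Gamma (a+d) * Real.Gamma (b+c) *
          Real.Gamma (b+d) * Real.Gamma (c+d) / Real.Gamma (a+b+c+d)

theorem wR_pos {a b c d : ℝ} (ha : 0 < a) (hb : 0 < b) (hc : 0 < c) (hd : 0 < d) :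
    0 < wR a b c d := by
  unfold wR
  have := Real.Gamma_pos_of_pos (add_pos ha hb)
  have := Real.Gamma_pos_of_pos (add_pos ha hc)
  have := Real.Gamma_pos_of_pos (add_pos ha hd)
  have := Real.Gamma_pos_of_pos (add_pos hb hc)
  have := Real.Gamma_pos_of_pos (add_pos hb hd)
  have := Real.Gamma_pos_of_pos (add_pos hc hd)
  have := Real.Gamma_pos_of_pos (add_pos (add_pos (add_pos ha hb) hc) hd)
  positivity

theorem wR_rec {a b c d : ℝ} (ha : 0 < a) (hb : 0 < b) (hc : 0 < c) (hd : 0 < d) :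
    (a + b + c + d) * wR (a + 1) b c d = (a + b) * (a + c) * (a + d) * wR a b c d := by
  unfold wR
  have e1 : a + 1 + b = (a + b) + 1 := by ring
  have e2 : a + 1 + c = (a + c) + 1 := by ring
  have e3 : a + 1 + d = (a + d) + 1 := by ring
  have e4 : a + b + 1 + c + d = (a + b + c + d) + 1 := by ring
  rw [e1, e2, e3, e4, Real.Gamma_add_one (by positivity), Real.Gamma_add_one (by positivity),
    Real.Gamma_add_one (by positivity), Real.Gamma_add_one (by positivity)]
  have := Real.Gamma_pos_of_pos (add_pos (add_pos (add_pos ha hb) hc) hd)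
  field_simp

theorem wR_swap (a b c d : ℝ) : wR a b c d = wR b a c d := by
  unfold wR; rw [add_comm b a]; ring

theorem wR_rot (a b c d : ℝ) : wR a b c d = wR b c d a := by
  unfold wR
  rw [add_comm b a, add_comm c a, add_comm d a, show b + c + d + a = a + b + c + d by ring]; ring

theorem wl_iter {a b c d : ℝ} (ha : 0 < a) (hb : 0 < b) (hc : 0 < c) (hd : 0 < d) (n : ℕ) :
    wI (a + n) b c d * wR a b c d = wI a b c d * wR (a + n) b c d := by
  induction n with
  | zero => simp
  | succ n ih =>
    have han : 0 < a + n := by positivity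
    have r1 := wI_rec han hb hc hd
    have r2 := wR_rec han hb hc hd
    have hs : a + n + b + c + d ≠ 0 := by positivity
    push_cast
    rw [← add_assoc]
    apply mul_left_cancel₀ hs
    linear_combination wR a b c d * r1 - wI a b c d * r2 +
      (a + n + b) * (a + n + c) * (a + n + d) * ih

theorem wl_Gamma_prod (s : ℂ) (hs : ∀ m : ℕ, s ≠ -m) (n : ℕ) :
    Gamma (s + n) = Gamma s * ∏ j ∈ Finset.range n, (s + j) := by
  induction n with
  | zero => simp
  | succ n ih =>
    rw [Finset.prod_range_succ, ← mul_assoc, ← ih]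
    push_cast
    rw [← add_assoc, Gamma_add_one _ (fun h => hs n (eq_neg_of_add_eq_zero_left h))]
    ring

theorem wl_lim (s : ℂ) (hs : 0 < s.re) :
    Filter.Tendsto (fun n : ℕ => ‖Gamma (s + (n + 1 : ℕ))‖ / ((n:ℝ) ^ s.re * n.factorial))
      Filter.atTop (nhds 1) := by
  have hne : ∀ m : ℕ, s ≠ -m := by
    intro m h
    have := congrArg re h
    simp at this
    have hm : (0:ℝ) ≤ m := Nat.cast_nonneg m
    linarith
  have hG : Gamma s ≠ 0 := Gamma_ne_zero hne
  have h := (GammaSeq_tendsto_Gamma s).norm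
  have h2 := (tendsto_const_nhds (x := ‖Gamma s‖)).div h (by simpa using hG)
  rw [div_self (by simpa using hG)] at h2
  refine h2.congr' ?_
  filter_upwards [Filter.eventually_gt_atTop 0] with n hn
  simp only [Pi.div_apply, Complex.GammaSeq]
  rw [wl_Gamma_prod s hne, norm_div, norm_mul, norm_mul, norm_natCast_cpow_of_pos hn]
  simp only [Complex.norm_natCast]
  rw [div_div_eq_mul_div]

theorem wl_lim_real (x : ℝ) (hx : 0 < x) :
    Filter.Tendsto (fun n : ℕ => Real.Gamma (x + (n + 1 : ℕ)) / ((n:ℝ) ^ x * n.factorial))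
      Filter.atTop (nhds 1) := by
  have := wl_lim x (by simpa using hx)
  refine this.congr (fun n => ?_)
  have : (x : ℂ) + (n + 1 : ℕ) = ((x + (n + 1 : ℕ) : ℝ) : ℂ) := by push_cast; ring
  rw [this, Gamma_ofReal, norm_real, Real.norm_of_nonneg (Real.Gamma_pos_of_pos (by positivity)).le,
    ofReal_re]

noncomputable def wK (a : ℝ) (n : ℕ) : ℝ := ((n:ℝ) ^ a * n.factorial)^2

theorem wl_limR {a b c d : ℝ} (ha : 0 < a) (hb : 0 < b) (hc : 0 < c) (hd : 0 < d) :
    Filter.Tendsto (fun n : ℕ => wR (a + (n + 1 : ℕ)) b c d / wK a n) Filter.atTop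
      (nhds (Real.Gamma (b+c) * Real.Gamma (b+d) * Real.Gamma (c+d))) := by
  have l1 := wl_lim_real (a + b) (by positivity)
  have l2 := wl_lim_real (a + c) (by positivity)
  have l3 := wl_lim_real (a + d) (by positivity)
  have l4 := wl_lim_real (a + b + c + d) (by positivity)
  have l := ((((l1.mul l2).mul l3).div l4 one_ne_zero).mul_const
    (Real.Gamma (b+c) * Real.Gamma (b+d) * Real.Gamma (c+d)))
  simp only [mul_one, div_one, one_mul] at l
  refine l.congr' ?_
  filter_upwards [Filter.eventually_gt_atTop 0] with n hn
  have hn : (0:ℝ) < n := by exact_mod_cast hn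
  simp only [Pi.div_apply]
  unfold wR wK
  have e1 : a + (n + 1 : ℕ) + b = (a + b) + (n + 1 : ℕ) := by ring
  have e2 : a + (n + 1 : ℕ) + c = (a + c) + (n + 1 : ℕ) := by ring
  have e3 : a + (n + 1 : ℕ) + d = (a + d) + (n + 1 : ℕ) := by ring
  have e4 : a + b + (n + 1 : ℕ) + c + d = (a + b + c + d) + (n + 1 : ℕ) := by ring
  rw [e1, e2, e3, e4, Real.rpow_add hn, Real.rpow_add hn, Real.rpow_add hn, Real.rpow_add hn,
    Real.rpow_add hn, Real.rpow_add hn]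
  have := Real.Gamma_pos_of_pos (show 0 < (a + b + c + d) + (n + 1 : ℕ) by positivity)
  have := Real.rpow_pos_of_pos hn a
  have := Real.rpow_pos_of_pos hn b
  have := Real.rpow_pos_of_pos hn c
  have := Real.rpow_pos_of_pos hn d
  have : (0:ℝ) < n.factorial := by exact_mod_cast n.factorial_pos
  field_simp

theorem wl_limI {a b c d : ℝ} (ha : 0 < a) (hb : 0 < b) (hc : 0 < c) (hd : 0 < d) :
    Filter.Tendsto (fun n : ℕ => wI (a + (n + 1 : ℕ)) b c d / wK a n) Filter.atTop
      (nhds (∫ τ in Set.Ioi (0:ℝ), wV b c d τ)) := by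
  have hL := (wl_lim_real a ha).pow 2
  obtain ⟨M, hM⟩ := hL.bddAbove_range
  have hI : ∀ n : ℕ, wI (a + (n + 1 : ℕ)) b c d / wK a n =
      ∫ τ in Set.Ioi (0:ℝ), wN (a + (n + 1 : ℕ)) τ / wK a n * wV b c d τ := by
    intro n
    unfold wI
    rw [← integral_div]
    congr 1; ext τ; ring
  simp only [hI]
  have hK : ∀ n, 0 ≤ wK a n := fun n => by unfold wK; positivity
  refine tendsto_integral_of_dominated_convergence (fun τ => M * ‖wV b c d τ‖) ?_ ?_ ?_ ?_
  · intro n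
    have := wN_cont (show 0 < a + (n + 1 : ℕ) by positivity)
    exact ((this.div_const _).mul (wV_cont hb hc hd)).aestronglyMeasurable
  · exact (wV_int hb hc hd).norm.const_mul M
  · intro n
    refine Filter.Eventually.of_forall fun τ => ?_
    rw [norm_mul, Real.norm_of_nonneg (div_nonneg (wN_nonneg _ _) (hK n))]
    refine mul_le_mul_of_nonneg_right ?_ (norm_nonneg _)
    refine le_trans ?_ (hM ⟨n, rfl⟩)
    simp only
    rw [div_pow]
    exact div_le_div_of_nonneg_right (wN_le (by positivity) τ) (hK n)
  · refine Filter.Eventually.of_forall fun τ => ?_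
    have h := (wl_lim ((a : ℂ) + τ/2 * I) (by simpa using ha)).pow 2
    have h2 := h.mul_const (wV b c d τ)
    rw [one_pow, one_mul] at h2
    refine h2.congr (fun n => ?_)
    have e1 : ((a : ℂ) + τ/2 * I).re = a := by simp
    have e2 : ((a : ℂ) + τ/2 * I) + (n + 1 : ℕ) = ((a + (n + 1 : ℕ) : ℝ) : ℂ) + τ/2 * I := by
      push_cast; ring
    rw [e1, e2, div_pow, ← normSq_eq_norm_sq]
    rfl

theorem wl_indep {a b c d : ℝ} (ha : 0 < a) (hb : 0 < b) (hc : 0 < c) (hd : 0 < d) :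
    wI a b c d / wR a b c d = (∫ τ in Set.Ioi (0:ℝ), wV b c d τ) /
      (Real.Gamma (b+c) * Real.Gamma (b+d) * Real.Gamma (c+d)) := by
  have l1 := (wl_limI ha hb hc hd).mul_const (wR a b c d)
  have l2 := (wl_limR ha hb hc hd).const_mul (wI a b c d)
  have heq : ∀ n : ℕ, wI (a + (n + 1 : ℕ)) b c d / wK a n * wR a b c d =
      wI a b c d * (wR (a + (n + 1 : ℕ)) b c d / wK a n) := by
    intro n
    have := wl_iter ha hb hc hd (n + 1)
    rw [div_mul_eq_mul_div, this]; ring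
  have := tendsto_nhds_unique (l1.congr heq) l2
  have p := wR_pos ha hb hc hd
  have := Real.Gamma_pos_of_pos (add_pos hb hc)
  have := Real.Gamma_pos_of_pos (add_pos hb hd)
  have := Real.Gamma_pos_of_pos (add_pos hc hd)
  rw [div_eq_div_iff p.ne' (by positivity)]
  linarith

theorem wl_change {a b c d : ℝ} (ha : 0 < a) (hb : 0 < b) (hc : 0 < c) (hd : 0 < d)
    {a' : ℝ} (ha' : 0 < a') : wI a b c d / wR a b c d = wI b c d a' / wR b c d a' := by
  rw [wl_indep ha hb hc hd, ← wI_rot, ← wR_rot, wl_indep ha' hb hc hd]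

theorem wl_const : wI (1/2) (1/2) (1/2) (1/2) = 4 * Real.pi^2 := by
  have hpi := Real.pi_pos
  have hN : ∀ τ, wN (1/2) τ = Real.pi / Real.cosh (Real.pi * τ / 2) := by
    intro τ
    have := wl_half (τ / 2)
    unfold wN
    rw [show Real.pi * τ / 2 = Real.pi * (τ / 2) by ring, ← this]
    push_cast; rfl
  have hW : ∀ τ, wN (1/2) τ * wV (1/2) (1/2) (1/2) τ =
      2 * Real.pi^4 * (τ * Real.sinh (Real.pi * τ / 2) / Real.cosh (Real.pi * τ / 2)^3) := by
    intro τ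
    unfold wV
    rw [hN]
    have : Real.pi * τ = 2 * (Real.pi * τ / 2) := by ring
    rw [show Real.sinh (Real.pi * τ) =
      2 * Real.sinh (Real.pi * τ / 2) * Real.cosh (Real.pi * τ / 2) by
        conv_lhs => rw [this]
        rw [Real.sinh_two_mul]]
    have := Real.cosh_pos (Real.pi * τ / 2)
    field_simp
  unfold wI
  simp only [hW]
  rw [integral_const_mul]
  have key := integral_Ioi_of_hasDerivAt_of_nonneg' (a := (0:ℝ)) (l := 2 / Real.pi^2)
    (g := fun τ => 2 / Real.pi^2 * (Real.sinh (Real.pi * τ / 2) / Real.cosh (Real.pi * τ / 2)) -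
      1 / Real.pi * (τ / Real.cosh (Real.pi * τ / 2)^2))
    (g' := fun τ => τ * Real.sinh (Real.pi * τ / 2) / Real.cosh (Real.pi * τ / 2)^3) ?_ ?_ ?_
  · rw [key]; simp; field_simp; norm_num
  · intro τ _
    have hc := Real.cosh_pos (Real.pi * τ / 2)
    have hl : HasDerivAt (fun τ : ℝ => Real.pi * τ / 2) (Real.pi / 2) τ := by
      simpa using ((hasDerivAt_id τ).const_mul Real.pi).div_const 2
    have hs := hl.sinh
    have hch := hl.cosh
    have := ((hs.div hch hc.ne').const_mul (2 / Real.pi^2)).sub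
      (((hasDerivAt_id τ).div (hch.pow 2) (pow_pos hc 2).ne').const_mul (1 / Real.pi))
    refine this.congr_deriv ?_
    have h2 := Real.cosh_sq (Real.pi * τ / 2)
    simp only [id, Pi.pow_apply]
    generalize Real.cosh (Real.pi * τ / 2) = C at *
    generalize Real.sinh (Real.pi * τ / 2) = S at *
    field_simp
    linear_combination 2 * C^2 * h2
  · intro τ hτ
    have hτ : 0 < τ := hτ
    have h1 := Real.cosh_pos (Real.pi * τ / 2)
    have h2 : 0 ≤ Real.sinh (Real.pi * τ / 2) := Real.sinh_nonneg_iff.2 (by positivity)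
    positivity
  · have t1 : Filter.Tendsto (fun τ : ℝ => Real.sinh (Real.pi * τ / 2) / Real.cosh (Real.pi * τ / 2))
        Filter.atTop (nhds 1) := by
      have hu : Filter.Tendsto (fun τ : ℝ => Real.pi / 2 * τ) Filter.atTop Filter.atTop :=
        Filter.Tendsto.const_mul_atTop (by positivity) Filter.tendsto_id
      have h0 := Real.tendsto_exp_neg_atTop_nhds_zero.comp hu
      have h1 : Filter.Tendsto (fun τ : ℝ => Real.exp (-(Real.pi * τ / 2)) /
          Real.cosh (Real.pi * τ / 2)) Filter.atTop (nhds 0) := by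
        refine squeeze_zero (fun τ => ?_) (fun τ => ?_) h0
        · have := Real.cosh_pos (Real.pi * τ / 2)
          positivity
        · simp only [Function.comp]
          rw [show Real.pi / 2 * τ = Real.pi * τ / 2 by ring]
          exact div_le_self (Real.exp_nonneg _) (Real.one_le_cosh _)
      have h2 := h1.const_sub 1
      rw [sub_zero] at h2
      refine h2.congr (fun τ => ?_)
      have := Real.cosh_pos (Real.pi * τ / 2)
      rw [← Real.cosh_sub_sinh]
      field_simp
      ring
    have t2 : Filter.Tendsto (fun τ : ℝ => τ / Real.cosh (Real.pi * τ / 2)^2)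
        Filter.atTop (nhds 0) := by
      have hu : Filter.Tendsto (fun τ : ℝ => Real.pi * τ) Filter.atTop Filter.atTop :=
        Filter.Tendsto.const_mul_atTop (by positivity) Filter.tendsto_id
      have h0 := ((Real.tendsto_pow_mul_exp_neg_atTop_nhds_zero 1).comp hu).const_mul (4 / Real.pi)
      rw [mul_zero] at h0
      refine squeeze_zero' ?_ ?_ h0
      · filter_upwards [Filter.eventually_ge_atTop 0] with τ hτ
        positivity
      · filter_upwards [Filter.eventually_ge_atTop 0] with τ hτ
        have hc := Real.cosh_pos (Real.pi * τ / 2)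
        have hE := Real.exp_pos (Real.pi * τ / 2)
        have h1 : Real.exp (Real.pi * τ / 2) / 2 ≤ Real.cosh (Real.pi * τ / 2) := by
          rw [Real.cosh_eq]
          have := Real.exp_pos (-(Real.pi * τ / 2))
          linarith
        have h2 : Real.exp (Real.pi * τ) = Real.exp (Real.pi * τ / 2)^2 := by
          rw [← Real.exp_nat_mul]; push_cast; ring_nf
        calc τ / Real.cosh (Real.pi * τ / 2)^2 ≤ τ / (Real.exp (Real.pi * τ / 2) / 2)^2 := by
              gcongr
          _ = _ := by
            simp only [Function.comp, pow_one]
            rw [Real.exp_neg, h2]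
            field_simp
            norm_num
    have := (t1.const_mul (2 / Real.pi^2)).sub (t2.const_mul (1 / Real.pi))
    simpa using this

theorem wilson_integral (a b c d : ℝ) (ha : 0 < a) (hb : 0 < b) (hc : 0 < c)
    (hd : 0 < d) :
    (1 / (4 * Real.pi^2)) *
      ∫ τ in Set.Ioi (0:ℝ), τ * Real.sinh (Real.pi * τ) *
        Complex.normSq
          (Complex.Gamma (a + τ/2 * Complex.I) * Complex.Gamma (b + τ/2 * Complex.I) *
            Complex.Gamma (c + τ/2 * Complex.I) * Complex.Gamma (d + τ/2 * Complex.I))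
      = Real.Gamma (a+b) * Real.Gamma (a+c) * Real.Gamma (a+d) * Real.Gamma (b+c) *
          Real.Gamma (b+d) * Real.Gamma (c+d) / Real.Gamma (a+b+c+d) := by
  have hI : ∫ τ in Set.Ioi (0:ℝ), τ * Real.sinh (Real.pi * τ) *
        Complex.normSq
          (Complex.Gamma (a + τ/2 * Complex.I) * Complex.Gamma (b + τ/2 * Complex.I) *
            Complex.Gamma (c + τ/2 * Complex.I) * Complex.Gamma (d + τ/2 * Complex.I)) =
      wI a b c d := by
    unfold wI wV wN
    congr 1; ext τ
    simp only [map_mul]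
    ring
  rw [hI]
  change _ = wR a b c d
  have h2 : (0:ℝ) < 1/2 := by norm_num
  have h := wl_change ha hb hc hd h2
  rw [wl_change hb hc hd h2 h2, wl_change hc hd h2 h2 h2, wl_change hd h2 h2 h2 h2, wl_const] at h
  have hR : wR (1/2) (1/2) (1/2) (1/2) = 1 := by
    unfold wR
    norm_num [Real.Gamma_one, Real.Gamma_two]
  rw [hR, div_one, div_eq_iff (wR_pos ha hb hc hd).ne'] at h
  rw [h]
  have := Real.pi_pos
  field_simp
end
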